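/- (Time-uniform estimate of the effective viscous flux) Let (ρ, u) be a radially symmetric strong solution on [0,R] × [0,T], set R_T = 1 + sup_{[0,R]×[0,T]} ρ, F = (2μ + ρ^β)(u_r + u/r) − ρ^γ, and λ = ρ^β. Then for any α ∈ (0,1) there is a constant C(α) depending only on α, μ, β, γ, ‖ρ₀‖_{L^∞} and ‖u₀‖_{H¹} (independent of T) such that sup_{0 ≤ t ≤ T} log( e + ∫_Ω F²/(2μ+λ) dx + ∫_Ω (2μ+λ) |div u|² dx ) ≤ C(α) ( R_T^{αβ+1} + R_T^{γ−2β+1} ). -/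

import Mathlib

open MeasureTheory Set Filter

noncomputable section

/-- Radial divergence `u_r + u/r` of the 2D radial vector field `x ↦ u(|x|,t) x/|x|`. -/
def rdiv (u : ℝ → ℝ → ℝ) (r t : ℝ) : ℝ := deriv (fun s => u s t) r + u r t / r

/-- Squared gradient `u_r² + u²/r²` of the 2D radial vector field. -/
def gradSq (u : ℝ → ℝ → ℝ) (r t : ℝ) : ℝ :=
  (deriv (fun s => u s t) r) ^ 2 + (u r t / r) ^ 2

/-- Material derivative `u̇ = u_t + u u_r` of the radial velocity. -/
def mder (u : ℝ → ℝ → ℝ) (r t : ℝ) : ℝ :=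
  deriv (fun τ => u r τ) t + u r t * deriv (fun s => u s t) r

/-- Effective viscous flux `F = (2μ + ρ^β)(u_r + u/r) - ρ^γ`. -/
def flux (μ β γ : ℝ) (ρ u : ℝ → ℝ → ℝ) (r t : ℝ) : ℝ :=
  (2 * μ + ρ r t ^ β) * rdiv u r t - ρ r t ^ γ

/-- A radially symmetric (smooth, strong) solution on `[0,R] × [0,T]` of the isentropic
compressible Navier–Stokes system with `μ > 0`, `λ(ρ) = ρ^β`, `P(ρ) = ρ^γ`, written in
radial coordinates: `ρ_t + (ρu)_r + ρu/r = 0` and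
`(ρu)_t + (ρu²)_r + ρu²/r + (ρ^γ)_r = [(2μ + ρ^β)(u_r + u/r)]_r`, with Dirichlet
boundary conditions `u(0,t) = u(R,t) = 0`. -/
structure RadialSolution (μ β γ R T : ℝ) (ρ u : ℝ → ℝ → ℝ) : Prop where
  hμ : 0 < μ
  hβ : 1 < β
  hγ : 1 < γ
  hR : 0 < R
  hT : 0 < T
  smooth_ρ : ∀ n : ℕ, ContDiff ℝ n (Function.uncurry ρ)
  smooth_u : ∀ n : ℕ, ContDiff ℝ n (Function.uncurry u)
  ρ_pos : ∀ r ∈ Icc 0 R, ∀ t ∈ Icc 0 T, 0 < ρ r t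
  mass : ∀ r ∈ Ioo 0 R, ∀ t ∈ Icc 0 T,
    deriv (fun τ => ρ r τ) t + deriv (fun s => ρ s t * u s t) r + ρ r t * u r t / r = 0
  momentum : ∀ r ∈ Ioo 0 R, ∀ t ∈ Icc 0 T,
    deriv (fun τ => ρ r τ * u r τ) t + deriv (fun s => ρ s t * u s t ^ 2) r
      + ρ r t * u r t ^ 2 / r + deriv (fun s => ρ s t ^ γ) r
      = deriv (fun s => (2 * μ + ρ s t ^ β) * rdiv u s t) r
  bc0 : ∀ t ∈ Icc 0 T, u 0 t = 0
  bcR : ∀ t ∈ Icc 0 T, u R t = 0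


/-- weighted integral -/
def wI (R : ℝ) (h : ℝ → ℝ) : ℝ := ∫ r in (0:ℝ)..R, h r * r

section W
variable {R : ℝ}

lemma wI_ii {h : ℝ → ℝ} (hh : Continuous h) (a b : ℝ) :
    IntervalIntegrable (fun r => h r * r) volume a b :=
  (hh.mul continuous_id).intervalIntegrable a b

lemma wI_add {a b : ℝ → ℝ} (ha : Continuous a) (hb : Continuous b) :
    wI R (fun r => a r + b r) = wI R a + wI R b := by
  unfold wI
  rw [← intervalIntegral.integral_add (wI_ii ha _ _) (wI_ii hb _ _)]
  congr 1; ext r; ring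

lemma wI_sub {a b : ℝ → ℝ} (ha : Continuous a) (hb : Continuous b) :
    wI R (fun r => a r - b r) = wI R a - wI R b := by
  unfold wI
  rw [← intervalIntegral.integral_sub (wI_ii ha _ _) (wI_ii hb _ _)]
  congr 1; ext r; ring

lemma wI_smul (c : ℝ) (a : ℝ → ℝ) :
    wI R (fun r => c * a r) = c * wI R a := by
  unfold wI
  rw [← intervalIntegral.integral_const_mul]
  congr 1; ext r; ring

lemma wI_const (c : ℝ) : wI R (fun _ => c) = c * (R ^ 2 / 2) := by
  unfold wI
  rw [intervalIntegral.integral_const_mul, integral_id]; ring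

lemma wI_congr (hR : 0 < R) {a b : ℝ → ℝ} (h : ∀ r ∈ Ioo 0 R, a r = b r) :
    wI R a = wI R b := by
  unfold wI
  rw [intervalIntegral.integral_of_le hR.le, intervalIntegral.integral_of_le hR.le,
    integral_Ioc_eq_integral_Ioo, integral_Ioc_eq_integral_Ioo]
  exact setIntegral_congr_fun measurableSet_Ioo (fun r hr => by simp only [h r hr])

lemma wI_mono (hR : 0 < R) {a b : ℝ → ℝ} (ha : Continuous a) (hb : Continuous b)
    (h : ∀ r ∈ Ioo 0 R, a r ≤ b r) : wI R a ≤ wI R b := by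
  unfold wI
  refine intervalIntegral.integral_mono_on_of_le_Ioo hR.le (wI_ii ha _ _) (wI_ii hb _ _) ?_
  intro r hr
  exact mul_le_mul_of_nonneg_right (h r hr) hr.1.le

lemma wI_nonneg (hR : 0 < R) {a : ℝ → ℝ} (ha : Continuous a)
    (h : ∀ r ∈ Ioo 0 R, 0 ≤ a r) : 0 ≤ wI R a := by
  have := wI_mono hR (continuous_const (y := (0:ℝ))) ha h
  simpa [wI_const] using this

lemma wI_abs (hR : 0 < R) {a : ℝ → ℝ} (ha : Continuous a) :
    |wI R a| ≤ wI R (fun r => |a r|) := by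
  rw [abs_le]
  constructor
  · have h1 : wI R (fun r => (-1) * a r) ≤ wI R (fun r => |a r|) :=
      wI_mono hR (by fun_prop) (by fun_prop) (fun r _ => by
        have := neg_le_abs (a r); linarith)
    rw [wI_smul] at h1; linarith
  · exact wI_mono hR ha (by fun_prop) (fun r _ => le_abs_self _)

/-- Cauchy–Schwarz -/
lemma wI_cs (hR : 0 < R) {a b : ℝ → ℝ} (ha : Continuous a) (hb : Continuous b) :
    (wI R (fun r => |a r * b r|)) ^ 2 ≤ wI R (fun r => a r ^ 2) * wI R (fun r => b r ^ 2) := by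
  have key : ∀ s : ℝ, 0 ≤ wI R (fun r => a r ^ 2) * (s * s)
      + (2 * wI R (fun r => |a r * b r|)) * s + wI R (fun r => b r ^ 2) := by
    intro s
    have h0 : 0 ≤ wI R (fun r => (s * s) * a r ^ 2 + ((2 * s) * |a r * b r| + b r ^ 2)) := by
      apply wI_nonneg hR (by fun_prop)
      intro r _
      rw [abs_mul, ← sq_abs (a r), ← sq_abs (b r)]
      nlinarith [sq_nonneg (s * |a r| + |b r|)]
    rw [wI_add (by fun_prop) (by fun_prop), wI_add (by fun_prop) (by fun_prop), wI_smul,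
      wI_smul] at h0
    linarith
  have := discrim_le_zero key
  unfold discrim at this
  nlinarith

lemma wI_cs' (hR : 0 < R) {a b : ℝ → ℝ} (ha : Continuous a) (hb : Continuous b) {x y : ℝ}
    (hx : 0 ≤ x) (hy : 0 ≤ y)
    (h1 : wI R (fun r => a r ^ 2) ≤ x ^ 2) (h2 : wI R (fun r => b r ^ 2) ≤ y ^ 2) :
    wI R (fun r => |a r * b r|) ≤ x * y := by
  have h := wI_cs hR ha hb
  have hb0 : 0 ≤ wI R (fun r => b r ^ 2) := wI_nonneg hR (by fun_prop) (fun r _ => sq_nonneg _)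
  apply abs_le_of_sq_le_sq' _ (by positivity) |>.2
  calc _ ≤ _ := h
    _ ≤ x ^ 2 * y ^ 2 := mul_le_mul h1 h2 hb0 (by positivity)
    _ = _ := by ring

/-- FTC on subintervals -/
lemma ftc {h k : ℝ → ℝ} (hh : Continuous h) (hk : Continuous k) {a b : ℝ} (ha : 0 ≤ a)
    (hab : a ≤ b) (hb : b ≤ R) (hd : ∀ r ∈ Ioo 0 R, HasDerivAt h (k r) r) :
    ∫ r in a..b, k r = h b - h a := by
  apply intervalIntegral.integral_eq_sub_of_hasDerivAt_of_le hab hh.continuousOn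
  · intro r hr
    exact hd r ⟨lt_of_le_of_lt ha hr.1, lt_of_lt_of_le hr.2 hb⟩
  · exact hk.intervalIntegrable _ _

lemma wI_tail {k : ℝ → ℝ} (hk : Continuous k) {a : ℝ} (ha : a ∈ Icc 0 R) :
    ∫ r in a..R, |k r| * r ≤ wI R (fun r => |k r|) := by
  unfold wI
  rw [← intervalIntegral.integral_add_adjacent_intervals (a := 0) (b := a) (c := R)
    (wI_ii (h := fun r => |k r|) (by fun_prop) _ _) (wI_ii (h := fun r => |k r|) (by fun_prop) _ _)]
  have : 0 ≤ ∫ r in (0:ℝ)..a, |k r| * r :=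
    intervalIntegral.integral_nonneg ha.1 (fun r hr => mul_nonneg (abs_nonneg _) hr.1)
  linarith

/-- pointwise bound -/
lemma pt_bound {h k : ℝ → ℝ} (hh : Continuous h) (hk : Continuous k)
    (hd : ∀ r ∈ Ioo 0 R, HasDerivAt h (k r) r) {a : ℝ} (ha : a ∈ Icc 0 R) :
    a * |h a| ≤ R * |h R| + wI R (fun r => |k r|) := by
  have h1 := ftc hh hk ha.1 ha.2 le_rfl hd
  have h2 : |∫ r in a..R, k r| ≤ ∫ r in a..R, |k r| :=
    intervalIntegral.abs_integral_le_integral_abs ha.2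
  have h3 : a * ∫ r in a..R, |k r| ≤ ∫ r in a..R, |k r| * r := by
    rw [← intervalIntegral.integral_const_mul]
    apply intervalIntegral.integral_mono_on ha.2
      ((by fun_prop : Continuous fun r => a * |k r|).intervalIntegrable _ _)
      (wI_ii (h := fun r => |k r|) (by fun_prop) _ _)
    intro r hr
    rw [mul_comm]
    exact mul_le_mul_of_nonneg_left hr.1 (abs_nonneg _)
  have h4 := wI_tail hk ha
  have h5 : |h a| ≤ |h R| + |∫ r in a..R, k r| := by
    rw [h1]
    have := abs_sub_abs_le_abs_sub (h a) (h R)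
    rw [abs_sub_comm] at this; linarith
  have h6 : a * |h a| ≤ a * |h R| + a * ∫ r in a..R, |k r| := by
    rw [← mul_add]; exact mul_le_mul_of_nonneg_left (h5.trans (by linarith)) ha.1
  have h7 : a * |h R| ≤ R * |h R| := mul_le_mul_of_nonneg_right ha.2 (abs_nonneg _)
  linarith

lemma sq_bound (hR : 0 < R) {h k : ℝ → ℝ} (hh : Continuous h) (hk : Continuous k)
    (hd : ∀ r ∈ Ioo 0 R, HasDerivAt h (k r) r) :
    wI R (fun r => h r ^ 2) ≤ (R * h R) ^ 2 / 2 +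
      (R * |h R| + wI R (fun r => |k r|)) * wI R (fun r => |k r|) := by
  have h1 := ftc (R := R) (h := fun r => r ^ 2 * h r ^ 2 / 2)
    (k := fun r => h r ^ 2 * r + (r * h r * k r) * r) (by fun_prop) (by fun_prop) le_rfl hR.le le_rfl
    (by
      intro r hr
      have := (((hasDerivAt_id r).pow 2).mul ((hd r hr).pow 2)).div_const 2
      refine this.congr_deriv ?_
      simp; ring)
  rw [intervalIntegral.integral_add (wI_ii (h := fun r => h r ^ 2) (by fun_prop) _ _)
    (wI_ii (h := fun r => r * h r * k r) (by fun_prop) _ _)] at h1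
  change wI R (fun r => h r ^ 2) + wI R (fun r => r * h r * k r) = _ at h1
  have h2 := wI_abs hR (a := fun r => r * h r * k r) (by fun_prop)
  have h3 : wI R (fun r => |r * h r * k r|) ≤
      wI R (fun r => (R * |h R| + wI R (fun r => |k r|)) * |k r|) := by
    apply wI_mono hR (by fun_prop) (by fun_prop)
    intro r hr
    rw [abs_mul, abs_mul, abs_of_pos hr.1]
    exact mul_le_mul_of_nonneg_right (pt_bound hh hk hd ⟨hr.1.le, hr.2.le⟩) (abs_nonneg _)
  rw [wI_smul] at h3
  have h4 := neg_le_of_abs_le h2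
  nlinarith

lemma bd_bound (hR : 0 < R) {h k : ℝ → ℝ} (hh : Continuous h) (hk : Continuous k)
    (hd : ∀ r ∈ Ioo 0 R, HasDerivAt h (k r) r) :
    R ^ 2 * |h R| ≤ 2 * wI R (fun r => |h r|) + R * wI R (fun r => |k r|) := by
  have h1 := ftc (R := R) (h := fun r => r ^ 2 * h r)
    (k := fun r => (2 * h r + r * k r) * r) (by fun_prop) (by fun_prop) le_rfl hR.le le_rfl
    (by
      intro r hr
      have := (((hasDerivAt_id r).pow 2).mul (hd r hr))
      refine this.congr_deriv ?_
      simp; ring)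
  change wI R (fun r => 2 * h r + r * k r) = _ at h1
  have h2 := wI_abs hR (a := fun r => 2 * h r + r * k r) (by fun_prop)
  have h3 : wI R (fun r => |2 * h r + r * k r|) ≤ wI R (fun r => 2 * |h r| + R * |k r|) := by
    apply wI_mono hR (by fun_prop) (by fun_prop)
    intro r hr
    refine (abs_add_le _ _).trans ?_
    rw [abs_mul, abs_mul, abs_of_pos hr.1, abs_two]
    gcongr
    exact hr.2.le
  rw [wI_add (by fun_prop) (by fun_prop), wI_smul, wI_smul] at h3
  have h4 : R ^ 2 * |h R| = |wI R (fun r => 2 * h r + r * k r)| := by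
    rw [h1]; simp [abs_mul]
  linarith

/-- `I[h²] ≤ (3/2) m²`. -/
lemma sob (hR : 0 < R) {h k : ℝ → ℝ} (hh : Continuous h) (hk : Continuous k)
    (hd : ∀ r ∈ Ioo 0 R, HasDerivAt h (k r) r) :
    wI R (fun r => h r ^ 2) ≤
      3 / 2 * (2 / R * wI R (fun r => |h r|) + 2 * wI R (fun r => |k r|)) ^ 2 := by
  have h1 := sq_bound hR hh hk hd
  have h2 := bd_bound hR hh hk hd
  set a := wI R (fun r => |h r|)
  set b := wI R (fun r => |k r|)
  have hb : 0 ≤ b := wI_nonneg hR (by fun_prop) (fun r _ => abs_nonneg _)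
  have ha : 0 ≤ a := wI_nonneg hR (by fun_prop) (fun r _ => abs_nonneg _)
  have h3 : R * |h R| ≤ 2 / R * a + b := by
    have : R * (R * |h R|) ≤ R * (2 / R * a + b) := by
      have e : R * (2 / R * a + b) = 2 * a + R * b := by field_simp
      rw [e]; linarith
    exact le_of_mul_le_mul_left this hR
  have h4 : (R * h R) ^ 2 = (R * |h R|) ^ 2 := by rw [mul_pow, mul_pow, sq_abs]
  rw [h4] at h1
  have h0 : 0 ≤ R * |h R| := by positivity
  have h5 : 0 ≤ 2 / R * a := by positivity
  generalize 2 / R * a = A at *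
  generalize R * |h R| = X at *
  nlinarith

lemma sob0 (hR : 0 < R) {h k : ℝ → ℝ} (hh : Continuous h) (hk : Continuous k)
    (hd : ∀ r ∈ Ioo 0 R, HasDerivAt h (k r) r) (h0 : h R = 0) :
    wI R (fun r => h r ^ 2) ≤ R ^ 2 / 2 * wI R (fun r => k r ^ 2) := by
  have h1 := sq_bound hR hh hk hd
  have h2 := wI_cs hR (a := fun _ => 1) (b := k) (by fun_prop) hk
  simp only [one_mul, one_pow, wI_const] at h2
  rw [h0] at h1
  simp at h1
  nlinarith

end W

section GN
variable {R : ℝ}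

lemma gn_step (hR : 0 < R) {f q : ℝ → ℝ} (hf : Continuous f) (hq : Continuous q)
    (hd : ∀ r ∈ Ioo 0 R, HasDerivAt f (q r) r) {c N : ℝ} (hc : 0 ≤ c) (hN : 0 ≤ N)
    (h1 : wI R (fun r => q r ^ 2) ≤ N ^ 2) (h2 : wI R (fun r => f r ^ 2) ≤ (c * N) ^ 2) (k : ℕ) :
    wI R (fun r => (f r ^ 2) ^ (k + 1)) ≤
      3 / 2 * (2 / R * c + 2 * (k + 1)) ^ 2 * N ^ 2 * wI R (fun r => (f r ^ 2) ^ k) := by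
  have hk0 : 0 ≤ wI R (fun r => (f r ^ 2) ^ k) :=
    wI_nonneg hR (by fun_prop) (fun r _ => by positivity)
  have hs := sob hR (h := fun r => f r ^ (k + 1)) (k := fun r => (k + 1) * (f r ^ k * q r))
    (by fun_prop) (by fun_prop) (fun r hr => by
      refine ((hd r hr).pow (k + 1)).congr_deriv ?_
      push_cast; ring)
  set S := Real.sqrt (wI R (fun r => (f r ^ 2) ^ k)) with hS
  have hS2 : S ^ 2 = wI R (fun r => (f r ^ 2) ^ k) := Real.sq_sqrt hk0
  have hSn : 0 ≤ S := Real.sqrt_nonneg _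
  have e1 : wI R (fun r => (f r ^ k) ^ 2) ≤ S ^ 2 := by
    rw [hS2]; apply le_of_eq; congr 1; ext r; ring
  have a1 := wI_cs' hR (b := fun r => f r ^ k) hf (by fun_prop) (mul_nonneg hc hN) hSn h2 e1
  have a2 := wI_cs' hR (a := fun r => f r ^ k) (by fun_prop) hq hSn hN e1 h1
  have e2 : wI R (fun r => |f r ^ (k + 1)|) = wI R (fun r => |f r * f r ^ k|) := by
    congr 1; ext r; congr 1; ring
  have e3 : wI R (fun r => |((k:ℝ) + 1) * (f r ^ k * q r)|)
      = (k + 1) * wI R (fun r => |f r ^ k * q r|) := by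
    rw [← wI_smul]; congr 1; ext r; rw [abs_mul, abs_of_pos (by positivity : (0:ℝ) < k + 1)]
  have e4 : wI R (fun r => (f r ^ (k + 1)) ^ 2) = wI R (fun r => (f r ^ 2) ^ (k + 1)) := by
    congr 1; ext r; ring
  rw [e2, e3, e4] at hs
  have p1 : 0 ≤ wI R (fun r => |f r * f r ^ k|) :=
    wI_nonneg hR (by fun_prop) (fun r _ => abs_nonneg _)
  have p2 : 0 ≤ wI R (fun r => |f r ^ k * q r|) :=
    wI_nonneg hR (by fun_prop) (fun r _ => abs_nonneg _)
  refine hs.trans ?_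
  calc _ ≤ 3 / 2 * (2 / R * (c * N * S) + 2 * ((k + 1) * (S * N))) ^ 2 := by
        have : (0:ℝ) ≤ 2 / R := by positivity
        gcongr
    _ = _ := by rw [← hS2]; ring

lemma gn_iter (hR : 0 < R) {c : ℝ} (hc : 0 ≤ c) (n : ℕ) :
    ∃ C : ℝ, 0 ≤ C ∧ ∀ (f q : ℝ → ℝ) (N : ℝ), Continuous f → Continuous q →
      (∀ r ∈ Ioo 0 R, HasDerivAt f (q r) r) → 0 ≤ N →
      wI R (fun r => q r ^ 2) ≤ N ^ 2 → wI R (fun r => f r ^ 2) ≤ (c * N) ^ 2 →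
      wI R (fun r => (f r ^ 2) ^ (n + 1)) ≤ C * (N ^ 2) ^ n * wI R (fun r => f r ^ 2) := by
  induction n with
  | zero =>
    refine ⟨1, zero_le_one, ?_⟩
    intro f q N _ _ _ _ _ _
    simp
  | succ n ih =>
    obtain ⟨C, hC, h⟩ := ih
    refine ⟨3 / 2 * (2 / R * c + 2 * ((n + 1 : ℕ) + 1)) ^ 2 * C, by positivity, ?_⟩
    intro f q N hf hq hd hN h1 h2
    have a := gn_step hR hf hq hd hc hN h1 h2 (n + 1)
    have b := h f q N hf hq hd hN h1 h2
    calc _ ≤ _ := a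
      _ ≤ 3 / 2 * (2 / R * c + 2 * ((n + 1 : ℕ) + 1)) ^ 2 * N ^ 2 *
          (C * (N ^ 2) ^ n * wI R (fun r => f r ^ 2)) := by gcongr
      _ = _ := by ring

lemma four_aux (x s : ℝ) (hx : 0 ≤ x) (hs : 0 < s) (m : ℕ) :
    x ^ 2 ≤ s * x + x ^ (m + 2) / s ^ m := by
  rcases le_total x s with h | h
  · have : 0 ≤ x ^ (m + 2) / s ^ m := by positivity
    nlinarith
  · have h1 : x ^ 2 ≤ x ^ (m + 2) / s ^ m := by
      rw [le_div_iff₀ (by positivity), pow_add, mul_comm]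
      gcongr
    have : 0 ≤ s * x := by positivity
    linarith

/-- weighted `L⁴` estimate -/
lemma four (hR : 0 < R) {c G : ℝ} (hc : 0 ≤ c) (hG : 0 ≤ G) (m : ℕ) :
    ∃ C : ℝ, 0 ≤ C ∧ ∀ (f q g : ℝ → ℝ) (N K L : ℝ), Continuous f → Continuous q → Continuous g →
      (∀ r ∈ Ioo 0 R, HasDerivAt f (q r) r) → 0 < N → 0 < K → 0 ≤ L → L ≤ K ^ (m + 1) →
      (∀ r ∈ Ioo 0 R, 0 ≤ g r ∧ g r ≤ G ∧ 1 ≤ L * g r) →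
      wI R (fun r => q r ^ 2) ≤ N ^ 2 → wI R (fun r => f r ^ 2) ≤ (c * N) ^ 2 →
      wI R (fun r => (f r ^ 2) ^ 2 * g r) ≤ C * K * N ^ 2 * wI R (fun r => f r ^ 2 * g r) := by
  obtain ⟨C, hC, h⟩ := gn_iter hR hc (m + 1)
  refine ⟨1 + G * C, by positivity, ?_⟩
  intro f q g N K L hf hq hg hd hN hK hL hLK hgb h1 h2
  have a := h f q N hf hq hd hN.le h1 h2
  have hs : 0 < N ^ 2 * K := by positivity
  have b : wI R (fun r => (f r ^ 2) ^ 2 * g r) ≤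
      wI R (fun r => (N ^ 2 * K) * (f r ^ 2 * g r)
        + (G / (N ^ 2 * K) ^ m) * (f r ^ 2) ^ (m + 1 + 1)) := by
    apply wI_mono hR (by fun_prop) (by fun_prop)
    intro r hr
    obtain ⟨g0, g1, _⟩ := hgb r hr
    have := four_aux (f r ^ 2) _ (sq_nonneg _) hs m
    calc (f r ^ 2) ^ 2 * g r ≤ (N ^ 2 * K * f r ^ 2 + (f r ^ 2) ^ (m + 2) / (N ^ 2 * K) ^ m) * g r :=
          mul_le_mul_of_nonneg_right this g0
      _ = N ^ 2 * K * (f r ^ 2 * g r) + g r / (N ^ 2 * K) ^ m * (f r ^ 2) ^ (m + 2) := by ring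
      _ ≤ _ := by gcongr
  rw [wI_add (by fun_prop) (by fun_prop), wI_smul, wI_smul] at b
  have d : wI R (fun r => f r ^ 2) ≤ L * wI R (fun r => f r ^ 2 * g r) := by
    rw [← wI_smul]
    apply wI_mono hR (by fun_prop) (by fun_prop)
    intro r hr
    have := (hgb r hr).2.2
    nlinarith [sq_nonneg (f r)]
  have d0 : 0 ≤ wI R (fun r => f r ^ 2 * g r) :=
    wI_nonneg hR (by fun_prop) (fun r hr => mul_nonneg (sq_nonneg _) (hgb r hr).1)
  set X := wI R (fun r => f r ^ 2 * g r)
  refine b.trans ?_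
  have e : G / (N ^ 2 * K) ^ m * wI R (fun r => (f r ^ 2) ^ (m + 1 + 1)) ≤
      G / (N ^ 2 * K) ^ m * (C * (N ^ 2) ^ (m + 1) * (K ^ (m + 1) * X)) := by
    refine mul_le_mul_of_nonneg_left (a.trans ?_) (by positivity)
    refine mul_le_mul_of_nonneg_left (d.trans ?_) (by positivity)
    gcongr
  have e2 : G / (N ^ 2 * K) ^ m * (C * (N ^ 2) ^ (m + 1) * (K ^ (m + 1) * X))
      = G * C * K * N ^ 2 * X := by
    field_simp; ring
  rw [e2] at e
  nlinarith

set_option maxHeartbeats 1000000 in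
lemma static (hR : 0 < R) {c1 G : ℝ} (hc1 : 0 < c1) (hG : 0 < G) (m : ℕ) :
    ∃ C : ℝ, 0 ≤ C ∧ ∀ (F q g v P : ℝ → ℝ) (N k L A D p : ℝ),
      Continuous F → Continuous q → Continuous g → Continuous v → Continuous P →
      (∀ r ∈ Ioo 0 R, HasDerivAt F (q r) r) → 0 < N → 1 ≤ k → 0 ≤ L → L ≤ (k ^ 2) ^ (m + 1) →
      0 ≤ A → 0 ≤ D → 0 ≤ p →
      (∀ r ∈ Ioo 0 R, 0 ≤ g r ∧ g r ≤ G ∧ 1 ≤ L * g r) →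
      (∀ r ∈ Ioo 0 R, 0 ≤ P r ∧ P r ≤ p) →
      (∀ r ∈ Ioo 0 R, v r = (F r + P r) * g r) →
      c1 ^ 2 ≤ wI R g →
      wI R (fun r => q r ^ 2) ≤ N ^ 2 →
      wI R (fun r => F r ^ 2 * g r) ≤ A ^ 2 →
      wI R (fun r => v r ^ 2) ≤ D ^ 2 →
      wI R (fun r => |F r| * v r ^ 2) ≤ C * (A * D ^ 2 + k * (A + p) * D * N) := by
  set c : ℝ := R * (1 + G * R ^ 2 / (2 * c1 ^ 2)) with hcdef
  have hc : 0 < c := by positivity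
  obtain ⟨C4, hC4, h4⟩ := four hR hc.le hG.le m
  refine ⟨1 / c1 + (1 + G) * (1 + C4) + (1 / c1 + 1) * (G * c), by positivity, ?_⟩
  intro F q g v P N k L A D p hF hq hg hv hP hd hN hk hL hLk hA hD hp hgb hPb hvd hgI hqN hFA hvD
  have hI : 0 < wI R g := lt_of_lt_of_le (by positivity) hgI
  obtain ⟨M, hM⟩ : ∃ M, M = wI R (fun r => g r * F r) / wI R g := ⟨_, rfl⟩
  have hMI : M * wI R g = wI R (fun r => g r * F r) := by rw [hM]; field_simp
  set f : ℝ → ℝ := fun r => F r - M with hf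
  have hfc : Continuous f := by fun_prop
  have hfd : ∀ r ∈ Ioo 0 R, HasDerivAt f (q r) r := fun r hr => (hd r hr).sub_const M
  -- orthogonality
  have orth : wI R (fun r => f r ^ 2 * g r) = wI R (fun r => F r ^ 2 * g r) - M ^ 2 * wI R g := by
    have : (fun r => f r ^ 2 * g r) =
        fun r => F r ^ 2 * g r + ((-(2 * M)) * (g r * F r) + M ^ 2 * g r) := by
      ext r; simp only [hf]; ring
    rw [this, wI_add (by fun_prop) (by fun_prop), wI_add (by fun_prop) (by fun_prop), wI_smul,
      wI_smul, ← hMI]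
    ring
  have fg0 : 0 ≤ wI R (fun r => f r ^ 2 * g r) :=
    wI_nonneg hR (by fun_prop) (fun r hr => mul_nonneg (sq_nonneg _) (hgb r hr).1)
  have fgA : wI R (fun r => f r ^ 2 * g r) ≤ A ^ 2 := by
    have : 0 ≤ M ^ 2 * wI R g := by positivity
    linarith
  have hMA : |M| ≤ A / c1 := by
    apply abs_le_of_sq_le_sq _ (by positivity)
    rw [div_pow, le_div_iff₀ (by positivity)]
    have : M ^ 2 * c1 ^ 2 ≤ M ^ 2 * wI R g := by gcongr
    linarith
  -- Poincare
  have hfN : wI R (fun r => f r ^ 2) ≤ (c * N) ^ 2 := by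
    have w1 := sob0 hR (h := fun r => F r - F R) (k := q) (by fun_prop) hq
      (fun r hr => (hd r hr).sub_const _) (by simp)
    have w2 := wI_cs hR (a := fun _ => 1) (b := fun r => F r - F R) (by fun_prop) (by fun_prop)
    simp only [one_mul, one_pow, wI_const] at w2
    have w1' : wI R (fun r => (F r - F R) ^ 2) ≤ R ^ 2 / 2 * N ^ 2 :=
      w1.trans (by gcongr)
    have w3 : wI R (fun r => |F r - F R|) ≤ R ^ 2 / 2 * N := by
      apply abs_le_of_sq_le_sq' _ (by positivity) |>.2
      calc _ ≤ _ := w2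
        _ ≤ R ^ 2 / 2 * (R ^ 2 / 2 * N ^ 2) := by gcongr
        _ = _ := by ring
    have w4 : (M - F R) * wI R g = wI R (fun r => g r * (F r - F R)) := by
      have : (fun r => g r * (F r - F R)) = fun r => g r * F r + (- F R) * g r := by ext r; ring
      rw [this, wI_add (by fun_prop) (by fun_prop), wI_smul, sub_mul, hMI]; ring
    have w5 : |wI R (fun r => g r * (F r - F R))| ≤ G * (R ^ 2 / 2 * N) := by
      refine (wI_abs hR (by fun_prop)).trans ?_
      refine le_trans ?_ (mul_le_mul_of_nonneg_left w3 hG.le)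
      rw [← wI_smul]
      apply wI_mono hR (by fun_prop) (by fun_prop)
      intro r hr
      rw [abs_mul, abs_of_nonneg (hgb r hr).1]
      exact mul_le_mul_of_nonneg_right (hgb r hr).2.1 (abs_nonneg _)
    rw [← w4, abs_mul, abs_of_pos hI] at w5
    have w6 : |M - F R| ≤ G * R ^ 2 / (2 * c1 ^ 2) * N := by
      have : |M - F R| * c1 ^ 2 ≤ G * (R ^ 2 / 2 * N) := le_trans (by gcongr) w5
      rw [div_mul_eq_mul_div, le_div_iff₀ (by positivity)]
      nlinarith
    have w7 : (M - F R) ^ 2 ≤ (G * R ^ 2 / (2 * c1 ^ 2) * N) ^ 2 := by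
      rw [← sq_abs]; gcongr
    have w8 : wI R (fun r => f r ^ 2) ≤ wI R (fun r => 2 * (F r - F R) ^ 2 + 2 * (M - F R) ^ 2) := by
      apply wI_mono hR (by fun_prop) (by fun_prop)
      intro r hr
      simp only [hf]
      nlinarith [sq_nonneg ((F r - F R) + (M - F R))]
    rw [wI_add (by fun_prop) (by fun_prop), wI_smul, wI_const] at w8
    have w9 : (0:ℝ) ≤ G * R ^ 2 / (2 * c1 ^ 2) := by positivity
    rw [hcdef]
    generalize G * R ^ 2 / (2 * c1 ^ 2) = z at *
    have w10 : 0 ≤ R ^ 2 * N ^ 2 * z := by positivity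
    calc _ ≤ _ := w8
      _ ≤ 2 * (R ^ 2 / 2 * N ^ 2) + 2 * (z * N) ^ 2 * (R ^ 2 / 2) := by gcongr
      _ = R ^ 2 * N ^ 2 + R ^ 2 * N ^ 2 * z ^ 2 := by ring
      _ ≤ R ^ 2 * N ^ 2 + R ^ 2 * N ^ 2 * z ^ 2 + 2 * (R ^ 2 * N ^ 2 * z) := by linarith
      _ = _ := by ring
  have hk0 : 0 < k := by linarith
  have f4 := h4 f q g N (k ^ 2) L hfc hq hg hfd hN (by positivity) hL hLk hgb hqN hfN
  -- split
  have s1 : wI R (fun r => |F r| * v r ^ 2) ≤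
      wI R (fun r => |M| * v r ^ 2 + (|(f r ^ 2 * g r) * v r| + (|M| + p) * |(f r * g r) * v r|)) := by
    apply wI_mono hR (by fun_prop) (by fun_prop)
    intro r hr
    obtain ⟨g0, g1, g2⟩ := hgb r hr
    obtain ⟨P0, P1⟩ := hPb r hr
    have t1 : |F r| ≤ |M| + |f r| := by
      have := abs_add_le M (f r)
      simpa [hf] using this
    have t2 : |v r| ≤ (|f r| + (|M| + p)) * g r := by
      rw [hvd r hr, abs_mul, abs_of_nonneg g0]
      refine mul_le_mul_of_nonneg_right ((abs_add_le _ _).trans ?_) g0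
      rw [abs_of_nonneg P0]; linarith
    have t3 : |f r| * v r ^ 2 ≤ |f r| * |v r| * ((|f r| + (|M| + p)) * g r) := by
      rw [← sq_abs (v r), pow_two, ← mul_assoc]
      gcongr
    rw [abs_mul, abs_mul, abs_mul, abs_mul, abs_of_nonneg g0, abs_of_nonneg (sq_nonneg (f r)),
      ← sq_abs (f r)]
    nlinarith [mul_le_mul_of_nonneg_right t1 (sq_nonneg (v r))]
  rw [wI_add (by fun_prop) (by fun_prop), wI_add (by fun_prop) (by fun_prop), wI_smul,
    wI_smul] at s1
  have u1 : wI R (fun r => |(f r ^ 2 * g r) * v r|) ≤ ((1 + G) * (1 + C4) * k * N * A) * D := by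
    apply wI_cs' hR (by fun_prop) hv (by positivity) hD _ hvD
    have : wI R (fun r => (f r ^ 2 * g r) ^ 2) ≤ G * wI R (fun r => (f r ^ 2) ^ 2 * g r) := by
      rw [← wI_smul]
      apply wI_mono hR (by fun_prop) (by fun_prop)
      intro r hr
      obtain ⟨g0, g1, g2⟩ := hgb r hr
      have : 0 ≤ (f r ^ 2) ^ 2 * g r := by positivity
      nlinarith
    calc _ ≤ _ := this
      _ ≤ G * (C4 * k ^ 2 * N ^ 2 * A ^ 2) := by gcongr; exact f4.trans (by gcongr)
      _ ≤ ((1 + G) ^ 2 * (1 + C4) ^ 2) * (k ^ 2 * N ^ 2 * A ^ 2) := by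
          rw [← mul_assoc, ← mul_assoc, ← mul_assoc]
          rw [mul_assoc (G * C4) , mul_assoc (G*C4)]
          have z1 : G * C4 ≤ (1 + G) ^ 2 * (1 + C4) ^ 2 := by
            have z2 : G ≤ (1 + G) ^ 2 := by nlinarith
            have z3 : C4 ≤ (1 + C4) ^ 2 := by nlinarith
            gcongr
          have : 0 ≤ k ^ 2 * N ^ 2 * A ^ 2 := by positivity
          nlinarith
      _ = _ := by ring
  have u2 : wI R (fun r => |(f r * g r) * v r|) ≤ (G * c * N) * D := by
    apply wI_cs' hR (by fun_prop) hv (by positivity) hD _ hvD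
    have : wI R (fun r => (f r * g r) ^ 2) ≤ G ^ 2 * wI R (fun r => f r ^ 2) := by
      rw [← wI_smul]
      apply wI_mono hR (by fun_prop) (by fun_prop)
      intro r hr
      obtain ⟨g0, g1, g2⟩ := hgb r hr
      rw [mul_pow, mul_comm]
      gcongr
    calc _ ≤ _ := this
      _ ≤ G ^ 2 * (c * N) ^ 2 := by gcongr
      _ = _ := by ring
  have v0 : 0 ≤ wI R (fun r => v r ^ 2) := wI_nonneg hR (by fun_prop) (fun r _ => sq_nonneg _)
  have r1 : |M| * wI R (fun r => v r ^ 2) ≤ 1 / c1 * (A * D ^ 2) := by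
    calc _ ≤ A / c1 * D ^ 2 := by gcongr
      _ = _ := by ring
  have r2 : (1 + G) * (1 + C4) * k * N * A * D ≤ (1 + G) * (1 + C4) * (k * (A + p) * D * N) := by
    have : 0 ≤ (1 + G) * (1 + C4) * (k * p * D * N) := by positivity
    nlinarith
  have r3 : (|M| + p) * wI R (fun r => |(f r * g r) * v r|) ≤
      (1 / c1 + 1) * (G * c) * (k * (A + p) * D * N) := by
    have z : |M| + p ≤ (1 / c1 + 1) * (A + p) := by
      have : (1 / c1 + 1) * (A + p) = A / c1 + p + (p / c1 + A) := by ring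
      have : 0 ≤ p / c1 + A := by positivity
      linarith
    have z0 : 0 ≤ wI R (fun r => |(f r * g r) * v r|) :=
      wI_nonneg hR (by fun_prop) (fun r _ => abs_nonneg _)
    calc _ ≤ ((1 / c1 + 1) * (A + p)) * (G * c * N * D) := by gcongr
      _ = (1 / c1 + 1) * (G * c) * (1 * (A + p) * D * N) := by ring
      _ ≤ _ := by gcongr
  have p1 : 0 ≤ (1 / c1) * (k * (A + p) * D * N) := by positivity
  have p2 : 0 ≤ ((1 + G) * (1 + C4) + (1 / c1 + 1) * (G * c)) * (A * D ^ 2) := by positivity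
  nlinarith

end GN

section RHS
variable {R : ℝ}

lemma grad_div (hR : 0 < R) {u ur w : ℝ → ℝ} (hu : Continuous u) (hur : Continuous ur)
    (hw : Continuous w) (hd : ∀ r ∈ Ioo 0 R, HasDerivAt u (ur r) r)
    (huw : ∀ r ∈ Ioo 0 R, u r = r * w r) (u0 : u 0 = 0) (uR : u R = 0) :
    wI R (fun r => ur r ^ 2 + w r ^ 2) = wI R (fun r => (ur r + w r) ^ 2) := by
  have h1 := ftc (R := R) (h := fun r => u r ^ 2) (k := fun r => 2 * u r * ur r)
    (by fun_prop) (by fun_prop) le_rfl hR.le le_rfl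
    (fun r hr => by
      refine ((hd r hr).pow 2).congr_deriv ?_
      simp)
  simp only [u0, uR] at h1
  have h2 : wI R (fun r => 2 * w r * ur r) = 0 := by
    have : wI R (fun r => 2 * w r * ur r) = ∫ r in (0:ℝ)..R, 2 * u r * ur r := by
      unfold wI
      rw [intervalIntegral.integral_of_le hR.le, intervalIntegral.integral_of_le hR.le,
        integral_Ioc_eq_integral_Ioo, integral_Ioc_eq_integral_Ioo]
      refine setIntegral_congr_fun measurableSet_Ioo (fun r hr => ?_)
      simp only [huw r hr]; ring
    rw [this, h1]; ring
  have : (fun r => (ur r + w r) ^ 2) = fun r => (ur r ^ 2 + w r ^ 2) + 2 * w r * ur r := by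
    ext r; ring
  rw [this, wI_add (a := fun r => ur r ^ 2 + w r ^ 2) (by fun_prop) (by fun_prop), h2, add_zero]

lemma sup_u {u ur w : ℝ → ℝ} (hu : Continuous u) (hur : Continuous ur)
    (hw : Continuous w) (hd : ∀ r ∈ Ioo 0 R, HasDerivAt u (ur r) r)
    (huw : ∀ r ∈ Ioo 0 R, u r = r * w r) (u0 : u 0 = 0) {a : ℝ} (ha : a ∈ Ioo 0 R) :
    u a ^ 2 ≤ wI R (fun r => ur r ^ 2 + w r ^ 2) := by
  have h1 := ftc (R := R) (h := fun r => u r ^ 2) (k := fun r => 2 * u r * ur r)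
    (by fun_prop) (by fun_prop) le_rfl ha.1.le ha.2.le
    (fun r hr => by
      refine ((hd r hr).pow 2).congr_deriv ?_
      simp)
  simp only [u0] at h1
  have h2 : ∫ r in (0:ℝ)..a, 2 * u r * ur r ≤ ∫ r in (0:ℝ)..a, (ur r ^ 2 + w r ^ 2) * r := by
    apply intervalIntegral.integral_mono_on_of_le_Ioo ha.1.le
      ((by fun_prop : Continuous fun r => 2 * u r * ur r).intervalIntegrable _ _)
      (wI_ii (h := fun r => ur r ^ 2 + w r ^ 2) (by fun_prop) _ _)
    intro r hr
    rw [huw r ⟨hr.1, hr.2.trans ha.2⟩]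
    nlinarith [mul_nonneg hr.1.le (sq_nonneg (ur r - w r))]
  have h3 : ∫ r in (0:ℝ)..a, (ur r ^ 2 + w r ^ 2) * r ≤ wI R (fun r => ur r ^ 2 + w r ^ 2) := by
    unfold wI
    rw [← intervalIntegral.integral_add_adjacent_intervals (a := 0) (b := a) (c := R)
      (wI_ii (h := fun r => ur r ^ 2 + w r ^ 2) (by fun_prop) _ _)
      (wI_ii (h := fun r => ur r ^ 2 + w r ^ 2) (by fun_prop) _ _)]
    have : 0 ≤ ∫ r in a..R, (ur r ^ 2 + w r ^ 2) * r :=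
      intervalIntegral.integral_nonneg ha.2.le
        (fun r hr => mul_nonneg (by positivity) (ha.1.le.trans hr.1))
    linarith
  nlinarith

lemma cubic_pt (μ β γ lam P V F p : ℝ) (hμ : 0 < μ) (hβ : 1 < β) (hγ : 1 < γ) (hl : 0 ≤ lam)
    (hP : 0 ≤ P) (hPp : P ≤ p) (hF : F = (2 * μ + lam) * V - P) :
    -2 * F * V ^ 2 + V ^ 3 * (2 * μ + lam - β * lam) + 2 * (γ - 1) * P * V ^ 2 ≤
      (3 + β) * (|F| * V ^ 2) + (1 + β + 2 * (γ - 1)) * p * V ^ 2 := by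
  have h1 : (2 * μ + lam) * V = F + P := by rw [hF]; ring
  have h2 : |lam * V| ≤ |F| + P := by
    calc |lam * V| ≤ |(2 * μ + lam) * V| := by
          rw [abs_mul, abs_mul, abs_of_nonneg hl, abs_of_pos (by linarith : 0 < 2 * μ + lam)]
          gcongr; linarith
      _ ≤ _ := by rw [h1]; exact (abs_add_le _ _).trans (by rw [abs_of_nonneg hP])
  have h3 : V ^ 3 * (2 * μ + lam - β * lam) = V ^ 2 * (F + P) - β * V ^ 2 * (lam * V) := by
    rw [← h1]; ring
  rw [h3]
  have h4 := neg_abs_le (lam * V)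
  have h5 := neg_abs_le F
  have h6 := le_abs_self F
  have hV : 0 ≤ V ^ 2 := sq_nonneg _
  have h7 : -(lam * V) ≤ |F| + P := by linarith
  have h8 : β * V ^ 2 * (-(lam * V)) ≤ β * V ^ 2 * (|F| + P) :=
    mul_le_mul_of_nonneg_left h7 (by positivity)
  have h9 : (1 + β + 2 * (γ - 1)) * (V ^ 2 * P) ≤ (1 + β + 2 * (γ - 1)) * (V ^ 2 * p) := by
    have : 0 ≤ γ - 1 := by linarith
    gcongr
  nlinarith

set_option maxHeartbeats 1000000 in
lemma rhs_bound (hR : 0 < R) {μ β γ c1 : ℝ} (hμ : 0 < μ) (hβ : 1 < β) (hγ : 1 < γ)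
    (hc1 : 0 < c1) (m : ℕ) :
    ∃ C : ℝ, 0 ≤ C ∧ ∀ (rho lam P u ur w F ud : ℝ → ℝ) (RT k L p y : ℝ),
      Continuous rho → Continuous lam → Continuous P → Continuous u → Continuous ur →
      Continuous w → Continuous F → Continuous ud →
      (∀ r ∈ Ioo 0 R, 0 ≤ rho r ∧ rho r ≤ RT) →
      (∀ r ∈ Ioo 0 R, 0 ≤ lam r ∧ 2 * μ + lam r ≤ L) →
      (∀ r ∈ Ioo 0 R, 0 ≤ P r ∧ P r ≤ p) →
      (∀ r ∈ Ioo 0 R, u r = r * w r) → u 0 = 0 → u R = 0 →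
      (∀ r ∈ Ioo 0 R, F r = (2 * μ + lam r) * (ur r + w r) - P r) →
      (∀ r ∈ Ioo 0 R, HasDerivAt F (rho r * ud r) r) →
      (∀ r ∈ Ioo 0 R, HasDerivAt u (ur r) r) →
      1 ≤ RT → 1 ≤ k → L ≤ (k ^ 2) ^ (m + 1) → 1 ≤ p →
      c1 ^ 2 ≤ wI R (fun r => 1 / (2 * μ + |lam r|)) →
      wI R (fun r => F r ^ 2 * (1 / (2 * μ + |lam r|))) + p ^ 2 ≤ y →
      wI R (fun r => (2 * μ + lam r) * (ur r + w r) ^ 2) ≤ C * y ∧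
      -2 * wI R (fun r => rho r * ud r ^ 2) - 2 * wI R (fun r => rho r * ud r * (u r * w r))
        + wI R (fun r => -2 * F r * (ur r + w r) ^ 2
            + (ur r + w r) ^ 3 * (2 * μ + lam r - β * lam r)
            + 2 * (γ - 1) * P r * (ur r + w r) ^ 2)
        ≤ C * (RT * k ^ 2) * wI R (fun r => (2 * μ + lam r) * (ur r + w r) ^ 2) * y := by
  set G := 1 / (2 * μ) with hGdef
  have hG : 0 < G := by positivity
  obtain ⟨Cs, hCs, hst⟩ := static hR hc1 hG m
  set c2 : ℝ := 2 + G * R ^ 2 with hc2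
  set Ca : ℝ := G ^ 2 * c2 + (3 + β) * Cs * (1 + G) ^ 2 + ((3 + β) * Cs * (1 + G)) ^ 2
    + (1 + β + 2 * (γ - 1)) * G with hCa
  have hγ' : 0 < γ - 1 := by linarith
  have hc20 : 0 < c2 := by positivity
  have hCa0 : 0 ≤ Ca := by positivity
  refine ⟨Ca + c2, by positivity, ?_⟩
  intro rho lam P u ur w F ud RT k L p y hrho hlam hP hu hur hw hF hud brho blam bP huw u0 uR
    hFdef hFd hud' hRT hk hL hp hg1 hy
  have hden : ∀ r, 0 < 2 * μ + |lam r| := fun r => by positivity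
  obtain ⟨g, hg⟩ : ∃ g : ℝ → ℝ, g = fun r => 1 / (2 * μ + |lam r|) := ⟨_, rfl⟩
  have hgc : Continuous g := by
    rw [hg]; exact continuous_const.div (by fun_prop) (fun r => (hden r).ne')
  have hgr : ∀ r, g r = 1 / (2 * μ + |lam r|) := fun r => by rw [hg]
  have hg1' : c1 ^ 2 ≤ wI R g := by rw [hg]; exact hg1
  simp only [← hgr] at hy
  have hgb : ∀ r ∈ Ioo 0 R, 0 ≤ g r ∧ g r ≤ G ∧ 1 ≤ L * g r ∧ g r * (2 * μ + lam r) = 1 := by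
    intro r hr
    obtain ⟨l0, l1⟩ := blam r hr
    have hd : 0 < 2 * μ + lam r := by positivity
    rw [hgr, abs_of_nonneg l0]
    refine ⟨by positivity, ?_, ?_, by field_simp⟩
    · rw [hGdef]; apply one_div_le_one_div_of_le <;> linarith
    · rw [mul_one_div, le_div_iff₀ hd]; linarith
  have hL0 : 0 ≤ L := by
    obtain ⟨l0, l1⟩ := blam (R / 2) ⟨by linarith, by linarith⟩
    linarith
  set V : ℝ → ℝ := fun r => ur r + w r with hV
  have hVc : Continuous V := by fun_prop
  set D := wI R (fun r => (2 * μ + lam r) * V r ^ 2) with hD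
  set B2 := wI R (fun r => rho r * ud r ^ 2) with hB2
  have hD0 : 0 ≤ D := wI_nonneg hR (by fun_prop) (fun r hr => by
    have := (blam r hr).1; positivity)
  have hB0 : 0 ≤ B2 := wI_nonneg hR (by fun_prop) (fun r hr => by
    have := (brho r hr).1; positivity)
  have hA20 : 0 ≤ wI R (fun r => F r ^ 2 * g r) := wI_nonneg hR (by fun_prop) (fun r hr =>
    mul_nonneg (sq_nonneg _) (hgb r hr).1)
  set A := Real.sqrt (wI R (fun r => F r ^ 2 * g r)) with hA
  have hA2 : A ^ 2 = wI R (fun r => F r ^ 2 * g r) := Real.sq_sqrt hA20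
  have hA0 : 0 ≤ A := Real.sqrt_nonneg _
  have hVF : ∀ r ∈ Ioo 0 R, V r = (F r + P r) * g r := by
    intro r hr
    obtain ⟨_, _, _, h4⟩ := hgb r hr
    rw [hFdef r hr]
    linear_combination (-(ur r + w r)) * h4
  have hVD : wI R (fun r => V r ^ 2) ≤ G * D := by
    rw [hD, ← wI_smul]
    apply wI_mono hR (by fun_prop) (by fun_prop)
    intro r hr
    have h1 : G * (2 * μ) = 1 := by rw [hGdef]; field_simp
    have h2 := (blam r hr).1
    have h3 : 0 ≤ G * lam r * V r ^ 2 := by positivity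
    calc V r ^ 2 = G * (2 * μ) * V r ^ 2 := by rw [h1, one_mul]
      _ ≤ G * (2 * μ) * V r ^ 2 + G * lam r * V r ^ 2 := by linarith
      _ = _ := by ring
  have hA2y : A ^ 2 + p ^ 2 ≤ y := by rw [hA2]; exact hy
  have hp2 : 1 ≤ p ^ 2 := one_le_pow₀ hp
  have hA2n := sq_nonneg A
  have hy1 : 1 ≤ y := by linarith
  have hAy : A ≤ y := by linarith [sub_sq A 1, sq_nonneg (A - 1)]
  have hpy : p ≤ y := by linarith [le_self_pow₀ hp (two_ne_zero)]
  have hApy : (A + p) ^ 2 ≤ 2 * y := by linarith [add_sq A p, sub_sq A p, sq_nonneg (A - p)]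
  have hDy : D ≤ c2 * y := by
    have h1 : D ≤ wI R (fun r => 2 * (F r ^ 2 * g r) + 2 * p ^ 2 * G) := by
      apply wI_mono hR (by fun_prop) (by fun_prop)
      intro r hr
      obtain ⟨g0, gG, _, h4⟩ := hgb r hr
      obtain ⟨P0, P1⟩ := bP r hr
      have e : (2 * μ + lam r) * V r ^ 2 = (F r + P r) ^ 2 * g r := by
        rw [hVF r hr]; linear_combination ((F r + P r) ^ 2 * g r) * h4
      rw [e]
      calc (F r + P r) ^ 2 * g r ≤ (2 * F r ^ 2 + 2 * p ^ 2) * g r := by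
            gcongr
            have q1 : P r ^ 2 ≤ p ^ 2 := by gcongr
            linarith [add_sq (F r) (P r), sub_sq (F r) (P r), sq_nonneg (F r - P r)]
        _ = 2 * (F r ^ 2 * g r) + 2 * p ^ 2 * g r := by ring
        _ ≤ _ := by gcongr
    rw [wI_add (by fun_prop) (by fun_prop), wI_smul, wI_const, ← hA2] at h1
    have h2 : A ^ 2 ≤ y := by linarith
    have h3 : p ^ 2 ≤ y := by linarith
    calc D ≤ _ := h1
      _ ≤ 2 * y + 2 * y * G * (R ^ 2 / 2) := by gcongr
      _ = c2 * y := by rw [hc2]; ring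
  refine ⟨hDy.trans (by
    have : 0 ≤ Ca * y := by positivity
    linarith [add_mul Ca c2 y]), ?_⟩
  apply le_of_forall_pos_le_add
  intro ε hε
  set b := Real.sqrt (B2 + ε / 2) with hb
  have hb2 : b ^ 2 = B2 + ε / 2 := Real.sq_sqrt (by positivity)
  have hb0 : 0 < b := Real.sqrt_pos.2 (by positivity)
  set s := Real.sqrt RT with hs
  have hs2 : s ^ 2 = RT := Real.sq_sqrt (by linarith)
  have hs0 : 0 < s := Real.sqrt_pos.2 (by linarith)
  set d := Real.sqrt D with hd
  have hd2 : d ^ 2 = D := Real.sq_sqrt hD0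
  have hd0 : 0 ≤ d := Real.sqrt_nonneg _
  have hqN : wI R (fun r => (rho r * ud r) ^ 2) ≤ (s * b) ^ 2 := by
    have : wI R (fun r => (rho r * ud r) ^ 2) ≤ RT * B2 := by
      rw [hB2, ← wI_smul]
      apply wI_mono hR (by fun_prop) (by fun_prop)
      intro r hr
      obtain ⟨h0, h1⟩ := brho r hr
      have : 0 ≤ rho r * ud r ^ 2 := by positivity
      calc (rho r * ud r) ^ 2 = rho r * (rho r * ud r ^ 2) := by ring
        _ ≤ _ := mul_le_mul_of_nonneg_right h1 this
    rw [mul_pow, hs2, hb2]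
    refine this.trans ?_
    gcongr; linarith
  have hVd : wI R (fun r => V r ^ 2) ≤ ((1 + G) * d) ^ 2 := by
    refine hVD.trans ?_
    rw [mul_pow, hd2]; gcongr
    linarith [add_sq 1 G, sq_nonneg G]
  have T2 := hst F (fun r => rho r * ud r) g V P (s * b) k L A ((1 + G) * d) p hF (by fun_prop)
    hgc hVc hP hFd (by positivity) hk hL0 hL hA0 (by positivity) (by linarith)
    (fun r hr => ⟨(hgb r hr).1, (hgb r hr).2.1, (hgb r hr).2.2.1⟩) bP hVF hg1' hqN hA2.ge hVd
  -- convective term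
  have hgd := grad_div hR hu hur hw hud' huw u0 uR
  have hGr : wI R (fun r => ur r ^ 2 + w r ^ 2) ≤ G * D := by rw [hgd]; exact hVD
  have huw2 : wI R (fun r => (u r * w r) ^ 2) ≤ (G * D) ^ 2 := by
    have h1 : wI R (fun r => (u r * w r) ^ 2) ≤ wI R (fun r => (G * D) * (ur r ^ 2 + w r ^ 2)) := by
      apply wI_mono hR (by fun_prop) (by fun_prop)
      intro r hr
      have := (sup_u hu hur hw hud' huw u0 hr).trans hGr
      rw [mul_pow]
      have h0 : 0 ≤ G * D := by positivity
      gcongr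
      linarith [sq_nonneg (ur r)]
    rw [wI_smul] at h1
    have h0 : 0 ≤ G * D := by positivity
    refine h1.trans ?_
    rw [pow_two]
    exact mul_le_mul_of_nonneg_left hGr h0
  have T1 := wI_cs' hR (a := fun r => rho r * ud r) (b := fun r => u r * w r) (by fun_prop)
    (by fun_prop) (by positivity) (by positivity) hqN huw2
  have T1' := neg_le_of_abs_le ((wI_abs hR (a := fun r => rho r * ud r * (u r * w r))
    (by fun_prop)).trans T1)
  -- cubic term
  have T3 : wI R (fun r => -2 * F r * V r ^ 2 + V r ^ 3 * (2 * μ + lam r - β * lam r)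
            + 2 * (γ - 1) * P r * V r ^ 2) ≤ wI R (fun r => (3 + β) * (|F r| * V r ^ 2)
            + ((1 + β + 2 * (γ - 1)) * p) * V r ^ 2) := by
    apply wI_mono hR (by fun_prop) (by fun_prop)
    intro r hr
    exact cubic_pt μ β γ (lam r) (P r) (V r) (F r) p hμ hβ hγ (blam r hr).1 (bP r hr).1
      (bP r hr).2 (hFdef r hr)
  rw [wI_add (a := fun r => (3 + β) * (|F r| * V r ^ 2)) (by fun_prop) (by fun_prop), wI_smul,
    wI_smul] at T3
  have hk2 : 1 ≤ k ^ 2 := one_le_pow₀ hk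
  have hRk : 1 ≤ RT * k ^ 2 := one_le_mul_of_one_le_of_one_le hRT hk2
  have hDyp : 0 ≤ D * y := by positivity
  -- assemble
  have Z1 : 2 * (s * b * (G * D)) ≤ b ^ 2 + (G ^ 2 * c2) * (RT * k ^ 2) * D * y := by
    have a1 : 2 * (s * b * (G * D)) ≤ b ^ 2 + (s * (G * D)) ^ 2 := by
      linarith [sub_sq b (s * (G * D)), sq_nonneg (b - s * (G * D))]
    have a2 : (s * (G * D)) ^ 2 = RT * G ^ 2 * D * D := by rw [mul_pow, hs2]; ring
    have a3 : RT * G ^ 2 * D * D ≤ RT * G ^ 2 * D * (c2 * y) := by gcongr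
    have a4 : RT * G ^ 2 * D * (c2 * y) ≤ (RT * k ^ 2) * G ^ 2 * D * (c2 * y) := by
      gcongr; exact le_mul_of_one_le_right (by linarith) hk2
    linarith
  have Z2 : (3 + β) * (Cs * (A * ((1 + G) * d) ^ 2)) ≤
      ((3 + β) * Cs * (1 + G) ^ 2) * (RT * k ^ 2) * D * y := by
    have e : (3 + β) * (Cs * (A * ((1 + G) * d) ^ 2))
        = ((3 + β) * Cs * (1 + G) ^ 2) * 1 * D * A := by rw [mul_pow, hd2]; ring
    rw [e]; gcongr
  have Z3 : (3 + β) * (Cs * (k * (A + p) * ((1 + G) * d) * (s * b))) ≤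
      b ^ 2 + ((3 + β) * Cs * (1 + G)) ^ 2 * (RT * k ^ 2) * D * y := by
    set x := ((3 + β) * Cs * (1 + G)) * (k * (A + p) * d * s) with hx
    have e : (3 + β) * (Cs * (k * (A + p) * ((1 + G) * d) * (s * b))) = x * b := by rw [hx]; ring
    have e2 : x ^ 2 = ((3 + β) * Cs * (1 + G)) ^ 2 * (RT * k ^ 2) * D * (A + p) ^ 2 := by
      rw [hx, ← hs2, ← hd2]; ring
    have e3 : x ^ 2 ≤ ((3 + β) * Cs * (1 + G)) ^ 2 * (RT * k ^ 2) * D * (2 * y) := by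
      rw [e2]; gcongr
    have e4 : 0 ≤ ((3 + β) * Cs * (1 + G)) ^ 2 * (RT * k ^ 2) * D * y := by positivity
    rw [e]
    have e5 := sq_nonneg (b - x / 2)
    have e6 : (b - x / 2) ^ 2 = b ^ 2 - x * b + x ^ 2 / 4 := by ring
    linarith
  have hV0 : 0 ≤ wI R (fun r => V r ^ 2) := wI_nonneg hR (by fun_prop) (fun r _ => sq_nonneg _)
  have Z4 : (1 + β + 2 * (γ - 1)) * p * wI R (fun r => V r ^ 2) ≤
      ((1 + β + 2 * (γ - 1)) * G) * (RT * k ^ 2) * D * y := by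
    calc _ ≤ (1 + β + 2 * (γ - 1)) * y * (G * D) := by gcongr
      _ = ((1 + β + 2 * (γ - 1)) * G) * 1 * D * y := by ring
      _ ≤ _ := by gcongr
  have Z5 : (3 + β) * wI R (fun r => |F r| * V r ^ 2) ≤
      (3 + β) * (Cs * (A * ((1 + G) * d) ^ 2))
      + (3 + β) * (Cs * (k * (A + p) * ((1 + G) * d) * (s * b))) := by
    rw [← mul_add, ← mul_add]; gcongr
  have Z6 : Ca * (RT * k ^ 2) * D * y = (G ^ 2 * c2) * (RT * k ^ 2) * D * y
      + ((3 + β) * Cs * (1 + G) ^ 2) * (RT * k ^ 2) * D * y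
      + ((3 + β) * Cs * (1 + G)) ^ 2 * (RT * k ^ 2) * D * y
      + ((1 + β + 2 * (γ - 1)) * G) * (RT * k ^ 2) * D * y := by rw [hCa]; ring
  have Z7 : 0 ≤ c2 * (RT * k ^ 2) * D * y := by positivity
  have Z8 : (Ca + c2) * (RT * k ^ 2) * D * y
      = Ca * (RT * k ^ 2) * D * y + c2 * (RT * k ^ 2) * D * y := by ring
  rw [Z8]
  change -2 * B2 - 2 * wI R (fun r => rho r * ud r * (u r * w r))
    + wI R (fun r => -2 * F r * V r ^ 2 + V r ^ 3 * (2 * μ + lam r - β * lam r)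
            + 2 * (γ - 1) * P r * V r ^ 2) ≤ _
  linarith

end RHS
section Smooth

/-- smoothness in both variables -/
def Sm (f : ℝ → ℝ → ℝ) : Prop := ∀ n : ℕ, ContDiff ℝ n (Function.uncurry f)

def dr (f : ℝ → ℝ → ℝ) (r t : ℝ) : ℝ := fderiv ℝ (Function.uncurry f) (r, t) (1, 0)
def dt (f : ℝ → ℝ → ℝ) (r t : ℝ) : ℝ := fderiv ℝ (Function.uncurry f) (r, t) (0, 1)

lemma Sm.sdr {f : ℝ → ℝ → ℝ} (h : Sm f) : Sm (dr f) := by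
  intro n
  have h1 : ContDiff ℝ n (fderiv ℝ (Function.uncurry f)) :=
    (h (n + 1)).fderiv_right (by norm_cast)
  exact h1.clm_apply contDiff_const

lemma Sm.sdt {f : ℝ → ℝ → ℝ} (h : Sm f) : Sm (dt f) := by
  intro n
  have h1 : ContDiff ℝ n (fderiv ℝ (Function.uncurry f)) :=
    (h (n + 1)).fderiv_right (by norm_cast)
  exact h1.clm_apply contDiff_const

lemma Sm.cont {f : ℝ → ℝ → ℝ} (h : Sm f) : Continuous (Function.uncurry f) :=
  (h 0).continuous

lemma Sm.hr {f : ℝ → ℝ → ℝ} (h : Sm f) (r t : ℝ) : HasDerivAt (fun s => f s t) (dr f r t) r := by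
  have h1 : HasFDerivAt (Function.uncurry f) (fderiv ℝ (Function.uncurry f) (r, t)) (r, t) :=
    ((h 1).differentiable (by norm_num) (r, t)).hasFDerivAt
  have h2 : HasDerivAt (fun s : ℝ => (s, t)) ((1 : ℝ), (0 : ℝ)) r :=
    (hasDerivAt_id r).prodMk (hasDerivAt_const r t)
  exact h1.comp_hasDerivAt r h2

lemma Sm.ht {f : ℝ → ℝ → ℝ} (h : Sm f) (r t : ℝ) : HasDerivAt (fun τ => f r τ) (dt f r t) t := by
  have h1 : HasFDerivAt (Function.uncurry f) (fderiv ℝ (Function.uncurry f) (r, t)) (r, t) :=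
    ((h 1).differentiable (by norm_num) (r, t)).hasFDerivAt
  have h2 : HasDerivAt (fun s : ℝ => (r, s)) ((0 : ℝ), (1 : ℝ)) t :=
    (hasDerivAt_const t r).prodMk (hasDerivAt_id t)
  exact h1.comp_hasDerivAt t h2

lemma Sm.comm {f : ℝ → ℝ → ℝ} (h : Sm f) (r t : ℝ) : dt (dr f) r t = dr (dt f) r t := by
  have hs : IsSymmSndFDerivAt ℝ (Function.uncurry f) (r, t) :=
    (h 2).contDiffAt.isSymmSndFDerivAt (by simp)
  have h1 : Differentiable ℝ (fderiv ℝ (Function.uncurry f)) :=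
    ((h 2).fderiv_right (m := 1) (by norm_num)).differentiable (by norm_num)
  have key : ∀ v w : ℝ × ℝ, fderiv ℝ (fun p => fderiv ℝ (Function.uncurry f) p v) (r, t) w
      = fderiv ℝ (fderiv ℝ (Function.uncurry f)) (r, t) w v := by
    intro v w
    have := ((h1 (r, t)).hasFDerivAt.clm_apply (hasFDerivAt_const v (r, t))).fderiv
    rw [this]; simp
  have e1 := key (1, 0) (0, 1)
  have e2 := key (0, 1) (1, 0)
  show fderiv ℝ (fun p => fderiv ℝ (Function.uncurry f) p (1, 0)) (r, t) (0, 1)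
    = fderiv ℝ (fun p => fderiv ℝ (Function.uncurry f) p (0, 1)) (r, t) (1, 0)
  rw [e1, e2, hs.eq]

lemma int_cont {G : ℝ → ℝ → ℝ} (hG : Continuous (Function.uncurry G)) (R : ℝ) :
    Continuous (fun t => ∫ r in (0:ℝ)..R, G r t) :=
  intervalIntegral.continuous_parametric_intervalIntegral_of_continuous'
    (f := fun t r => G r t) (by
      show Continuous (fun p : ℝ × ℝ => Function.uncurry G (p.2, p.1)); fun_prop) 0 R

lemma diffint {R T : ℝ} (hR : 0 < R) {G Gt : ℝ → ℝ → ℝ} (hG : Continuous (Function.uncurry G))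
    (hGt : Continuous (Function.uncurry Gt))
    (hd : ∀ r ∈ Ioo 0 R, ∀ t ∈ Ioo 0 T, HasDerivAt (fun τ => G r τ) (Gt r t) t) :
    ∀ t ∈ Ioo 0 T, HasDerivAt (fun t => ∫ r in (0:ℝ)..R, G r t) (∫ r in (0:ℝ)..R, Gt r t) t := by
  intro t ht
  obtain ⟨B, hB⟩ : ∃ B, ∀ p ∈ Icc (0:ℝ) R ×ˢ Icc (0:ℝ) T, ‖Function.uncurry Gt p‖ ≤ B :=
    (isCompact_Icc.prod isCompact_Icc).exists_bound_of_continuousOn hGt.continuousOn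
  have hc : ∀ t, Continuous (fun r => G r t) := fun t => by
    show Continuous (fun r => Function.uncurry G (r, t)); fun_prop
  have hct : ∀ t, Continuous (fun r => Gt r t) := fun t => by
    show Continuous (fun r => Function.uncurry Gt (r, t)); fun_prop
  have hae : ∀ᵐ r : ℝ, r ≠ R := by
    rw [ae_iff]; simp
  refine (intervalIntegral.hasDerivAt_integral_of_dominated_loc_of_deriv_le
    (F := fun t r => G r t) (F' := fun t r => Gt r t) (s := Ioo 0 T) (bound := fun _ => B)
    (Ioo_mem_nhds ht.1 ht.2) ?_ ?_ ?_ ?_ ?_ ?_).2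
  · exact Eventually.of_forall fun t => (hc t).aestronglyMeasurable
  · exact (hc t).intervalIntegrable _ _
  · exact (hct t).aestronglyMeasurable
  · filter_upwards [hae] with r hr hr' x hx
    rw [uIoc_of_le hR.le] at hr'
    exact hB (r, x) ⟨⟨hr'.1.le, hr'.2⟩, ⟨hx.1.le, hx.2.le⟩⟩
  · exact intervalIntegrable_const
  · filter_upwards [hae] with r hr hr' x hx
    rw [uIoc_of_le hR.le] at hr'
    exact hd r ⟨hr'.1, lt_of_le_of_ne hr'.2 hr⟩ x hx

/-- the quotient `u/r` as a continuous function -/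
def wq (u : ℝ → ℝ → ℝ) (r t : ℝ) : ℝ := ∫ s in (0:ℝ)..1, dr u (s * r) t

lemma wq_cont {u : ℝ → ℝ → ℝ} (h : Sm u) : Continuous (Function.uncurry (wq u)) := by
  have h1 := h.sdr.cont
  exact intervalIntegral.continuous_parametric_intervalIntegral_of_continuous'
    (f := fun (p : ℝ × ℝ) s => dr u (s * p.1) p.2) (by
      show Continuous (fun q : (ℝ × ℝ) × ℝ => Function.uncurry (dr u) (q.2 * q.1.1, q.1.2))
      fun_prop) 0 1

lemma wq_eq {u : ℝ → ℝ → ℝ} (h : Sm u) (r t : ℝ) : r * wq u r t = u r t - u 0 t := by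
  have h1 := intervalIntegral.mul_integral_comp_mul_right (f := fun x => dr u x t) r (a := 0) (b := 1)
  unfold wq
  rw [h1]
  simp only [zero_mul, one_mul]
  apply intervalIntegral.integral_eq_sub_of_hasDerivAt (fun x _ => h.hr x t)
  have hc : Continuous (fun x => dr u x t) := by
    have := h.sdr.cont
    show Continuous (fun x => Function.uncurry (dr u) (x, t)); fun_prop
  exact hc.intervalIntegrable _ _

end Smooth

section Pointwise
variable {μ β γ R T : ℝ} {ρ u : ℝ → ℝ → ℝ}

def VV (u : ℝ → ℝ → ℝ) (r t : ℝ) : ℝ := dr u r t + wq u r t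
def FF (μ β γ : ℝ) (ρ u : ℝ → ℝ → ℝ) (r t : ℝ) : ℝ :=
  (2 * μ + ρ r t ^ β) * (dr u r t + wq u r t) - ρ r t ^ γ
def UD (u : ℝ → ℝ → ℝ) (r t : ℝ) : ℝ := dt u r t + u r t * dr u r t

lemma RadialSolution.sr (h : RadialSolution μ β γ R T ρ u) : Sm ρ := h.smooth_ρ
lemma RadialSolution.su (h : RadialSolution μ β γ R T ρ u) : Sm u := h.smooth_u

lemma RadialSolution.uw (h : RadialSolution μ β γ R T ρ u) {t : ℝ} (ht : t ∈ Icc 0 T) (r : ℝ) :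
    u r t = r * wq u r t := by
  rw [wq_eq h.su, h.bc0 t ht, sub_zero]

lemma RadialSolution.wdiv (h : RadialSolution μ β γ R T ρ u) {t : ℝ} (ht : t ∈ Icc 0 T) {r : ℝ}
    (hr : r ≠ 0) : wq u r t = u r t / r := by
  rw [h.uw ht r]; field_simp

lemma RadialSolution.rdiv_eq (h : RadialSolution μ β γ R T ρ u) {t : ℝ} (ht : t ∈ Icc 0 T) {r : ℝ}
    (hr : r ≠ 0) : rdiv u r t = dr u r t + wq u r t := by
  rw [rdiv, (h.su.hr r t).deriv, h.wdiv ht hr]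

lemma RadialSolution.mass' (h : RadialSolution μ β γ R T ρ u) {r t : ℝ} (hr : r ∈ Ioo 0 R)
    (ht : t ∈ Icc 0 T) :
    dt ρ r t = - u r t * dr ρ r t - ρ r t * (dr u r t + wq u r t) := by
  have h1 := h.mass r hr t ht
  rw [(h.sr.ht r t).deriv, ((h.sr.hr r t).fun_mul (h.su.hr r t)).deriv] at h1
  rw [h.wdiv ht hr.1.ne']
  linear_combination h1

lemma RadialSolution.V_r (h : RadialSolution μ β γ R T ρ u) {r t : ℝ} (hr : r ∈ Ioo 0 R)
    (ht : t ∈ Icc 0 T) : HasDerivAt (fun s => dr u s t + wq u s t)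
      (dr (dr u) r t + (dr u r t - wq u r t) / r) r := by
  have h1 : HasDerivAt (fun s => dr u s t + u s t / s)
      (dr (dr u) r t + (dr u r t * r - u r t * 1) / r ^ 2) r :=
    (h.su.sdr.hr r t).add ((h.su.hr r t).div (hasDerivAt_id r) hr.1.ne')
  have h2 : (dr (dr u) r t + (dr u r t * r - u r t * 1) / r ^ 2)
      = (dr (dr u) r t + (dr u r t - wq u r t) / r) := by
    rw [h.uw ht r]; have := hr.1.ne'; field_simp
  rw [← h2]
  refine h1.congr_of_eventuallyEq ?_
  filter_upwards [Ioo_mem_nhds hr.1 hr.2] with s hs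
  rw [h.wdiv ht hs.1.ne']

lemma RadialSolution.V_t (h : RadialSolution μ β γ R T ρ u) {r t : ℝ} (hr : r ∈ Ioo 0 R)
    (ht : t ∈ Ioo 0 T) : HasDerivAt (fun τ => dr u r τ + wq u r τ)
      (dt (dr u) r t + dt u r t / r) t := by
  have h1 : HasDerivAt (fun τ => dr u r τ + u r τ / r) (dt (dr u) r t + dt u r t / r) t :=
    (h.su.sdr.ht r t).add ((h.su.ht r t).div_const r)
  refine h1.congr_of_eventuallyEq ?_
  filter_upwards [Ioo_mem_nhds ht.1 ht.2] with s hs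
  rw [h.wdiv ⟨hs.1.le, hs.2.le⟩ hr.1.ne']

lemma pow_r (h : Sm ρ) {p : ℝ} (hp : 1 ≤ p) (r t : ℝ) :
    HasDerivAt (fun s => ρ s t ^ p) (dr ρ r t * p * ρ r t ^ (p - 1)) r :=
  (h.hr r t).rpow_const (Or.inr hp)

lemma pow_t (h : Sm ρ) {p : ℝ} (hp : 1 ≤ p) (r t : ℝ) :
    HasDerivAt (fun s => ρ r s ^ p) (dt ρ r t * p * ρ r t ^ (p - 1)) t :=
  (h.ht r t).rpow_const (Or.inr hp)

lemma RadialSolution.F_r (h : RadialSolution μ β γ R T ρ u) {r t : ℝ} (hr : r ∈ Ioo 0 R)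
    (ht : t ∈ Icc 0 T) : HasDerivAt (fun s => FF μ β γ ρ u s t) (ρ r t * UD u r t) r := by
  have hV := h.V_r hr ht
  have hQ := ((pow_r h.sr h.hβ.le r t).const_add (2 * μ)).fun_mul hV
  have hP := pow_r h.sr h.hγ.le r t
  have hF := hQ.fun_sub hP
  have hm := h.momentum r hr t ht
  have hQ1 := hQ.congr_of_eventuallyEq (f₁ := fun s => (2 * μ + ρ s t ^ β) * rdiv u s t) (by
    filter_upwards [Ioo_mem_nhds hr.1 hr.2] with s hs
    rw [h.rdiv_eq ht hs.1.ne'])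
  rw [hQ1.deriv, ((h.sr.ht r t).fun_mul (h.su.ht r t)).deriv,
    ((h.sr.hr r t).fun_mul ((h.su.hr r t).fun_pow 2)).deriv, hP.deriv] at hm
  have hmass := h.mass' hr ht
  rw [hmass] at hm
  refine hF.congr_deriv ?_
  rw [← hm]
  have e : ρ r t * u r t ^ 2 / r = ρ r t * u r t * wq u r t := by
    rw [h.wdiv ht hr.1.ne']; ring
  rw [e]
  simp [UD]
  ring

end Pointwise

section Evolution
variable {μ β γ R T : ℝ} {ρ u : ℝ → ℝ → ℝ}

lemma Sm.c2 {f : ℝ → ℝ → ℝ} (h : Sm f) : Continuous (fun p : ℝ × ℝ => f p.1 p.2) := h.cont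

lemma wq_c2 {f : ℝ → ℝ → ℝ} (h : Sm f) : Continuous (fun p : ℝ × ℝ => wq f p.1 p.2) := wq_cont h

lemma slice {f : ℝ → ℝ → ℝ} (h : Continuous (fun p : ℝ × ℝ => f p.1 p.2)) (t : ℝ) :
    Continuous (fun r => f r t) :=
  h.comp (continuous_id.prodMk continuous_const)

lemma pow_c2 (h : Sm ρ) {p : ℝ} (hp : 0 ≤ p) : Continuous (fun q : ℝ × ℝ => ρ q.1 q.2 ^ p) :=
  h.c2.rpow_const (fun _ => Or.inr hp)

/-- energy -/
def EE (γ R : ℝ) (ρ u : ℝ → ℝ → ℝ) (t : ℝ) : ℝ :=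
  wI R (fun r => ρ r t * u r t ^ 2 / 2 + ρ r t ^ γ / (γ - 1))

/-- modified flux functional -/
def YY (μ β γ R : ℝ) (ρ u : ℝ → ℝ → ℝ) (t : ℝ) : ℝ :=
  wI R (fun r => (2 * μ + ρ r t ^ β) * (dr u r t + wq u r t) ^ 2
    - 2 * ρ r t ^ γ * (dr u r t + wq u r t))

def DD (μ β R : ℝ) (ρ u : ℝ → ℝ → ℝ) (t : ℝ) : ℝ :=
  wI R (fun r => (2 * μ + ρ r t ^ β) * (dr u r t + wq u r t) ^ 2)

lemma RadialSolution.pw (h : RadialSolution μ β γ R T ρ u) {r t p : ℝ} (hr : r ∈ Ioo 0 R)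
    (ht : t ∈ Icc 0 T) : ρ r t ^ p = ρ r t * ρ r t ^ (p - 1) := by
  have := h.ρ_pos r ⟨hr.1.le, hr.2.le⟩ t ht
  rw [Real.rpow_sub this, Real.rpow_one]; field_simp

set_option maxHeartbeats 1000000 in
lemma RadialSolution.E_t (h : RadialSolution μ β γ R T ρ u) {t : ℝ} (ht : t ∈ Ioo 0 T) :
    HasDerivAt (EE γ R ρ u) (- DD μ β R ρ u t) t := by
  have ht' : t ∈ Icc 0 T := ⟨ht.1.le, ht.2.le⟩
  have hβ := h.hβ
  have hγ := h.hγ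
  have hγ1 : γ - 1 ≠ 0 := by linarith
  have c1 := h.sr.c2
  have c2 := h.su.c2
  have c3 := h.sr.sdr.c2
  have c4 := h.su.sdr.c2
  have c5 := h.sr.sdt.c2
  have c6 := h.su.sdt.c2
  have c7 := wq_c2 h.su
  have c8 := pow_c2 h.sr (p := γ) (by linarith)
  have c9 := pow_c2 h.sr (p := γ - 1) (by linarith)
  have c10 := pow_c2 h.sr (p := β) (by linarith)
  have d1 := slice c1 t
  have d2 := slice c2 t
  have d3 := slice c3 t
  have d4 := slice c4 t
  have d5 := slice c5 t
  have d6 := slice c6 t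
  have d7 := slice c7 t
  have d8 := slice (f := fun r t => ρ r t ^ γ) c8 t
  have d9 := slice (f := fun r t => ρ r t ^ (γ - 1)) c9 t
  have d10 := slice (f := fun r t => ρ r t ^ β) c10 t
  have key := diffint (R := R) (T := T) h.hR
    (G := fun r t => (ρ r t * u r t ^ 2 / 2 + ρ r t ^ γ / (γ - 1)) * r)
    (Gt := fun r t => (dt ρ r t * u r t ^ 2 / 2 + ρ r t * u r t * dt u r t
      + (dt ρ r t * γ * ρ r t ^ (γ - 1)) / (γ - 1)) * r)
    (by simp only [Function.uncurry_def]; fun_prop) (by simp only [Function.uncurry_def]; fun_prop)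
    (by
      intro r hr t ht
      have h1 := ((((h.sr.ht r t).fun_mul ((h.su.ht r t).fun_pow 2)).div_const 2).fun_add
        ((pow_t h.sr h.hγ.le r t).div_const (γ - 1))).mul_const r
      refine h1.congr_deriv ?_
      simp only [Nat.cast_ofNat, Nat.add_one_sub_one, pow_one]
      ring) t ht
  have e := ftc (R := R) (h := fun r => r * u r t * FF μ β γ ρ u r t
      - r * u r t * (ρ r t * u r t ^ 2 / 2 + ρ r t ^ γ / (γ - 1)))
    (k := fun r => (dt ρ r t * u r t ^ 2 / 2 + ρ r t * u r t * dt u r t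
      + (dt ρ r t * γ * ρ r t ^ (γ - 1)) / (γ - 1)) * r
      + (2 * μ + ρ r t ^ β) * (dr u r t + wq u r t) ^ 2 * r)
    (by unfold FF; fun_prop) (by fun_prop) le_rfl h.hR.le le_rfl (by
      intro r hr
      have h0 := ((hasDerivAt_id r).fun_mul (h.su.hr r t))
      have h1 := (h0.fun_mul (h.F_r hr ht')).fun_sub
        (h0.fun_mul ((((h.sr.hr r t).fun_mul ((h.su.hr r t).fun_pow 2)).div_const 2).fun_add
        ((pow_r h.sr h.hγ.le r t).div_const (γ - 1))))
      refine h1.congr_deriv ?_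
      simp only [Nat.cast_ofNat, Nat.add_one_sub_one, pow_one, id_eq, FF, UD, h.mass' hr ht',
        h.uw ht' r]
      rw [h.pw (p := γ) hr ht']
      field_simp
      ring)
  rw [intervalIntegral.integral_add (by apply Continuous.intervalIntegrable; fun_prop)
    (by apply Continuous.intervalIntegrable; fun_prop)] at e
  have e0 : (∫ r in (0:ℝ)..R, (dt ρ r t * u r t ^ 2 / 2 + ρ r t * u r t * dt u r t
      + (dt ρ r t * γ * ρ r t ^ (γ - 1)) / (γ - 1)) * r) = - DD μ β R ρ u t := by
    unfold DD wI
    rw [h.bcR t ht', h.bc0 t ht'] at e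
    linear_combination e
  rw [← e0]
  exact key

end Evolution

section Evolution2
variable {μ β γ R T : ℝ} {ρ u : ℝ → ℝ → ℝ}

lemma RadialSolution.utR (h : RadialSolution μ β γ R T ρ u) {t : ℝ} (ht : t ∈ Ioo 0 T) :
    dt u R t = 0 := by
  refine (h.su.ht R t).unique ?_
  refine (hasDerivAt_const t (0:ℝ)).congr_of_eventuallyEq ?_
  filter_upwards [Ioo_mem_nhds ht.1 ht.2] with s hs
  exact h.bcR s ⟨hs.1.le, hs.2.le⟩

set_option maxHeartbeats 2000000 in
lemma RadialSolution.Y_t (h : RadialSolution μ β γ R T ρ u) {t : ℝ} (ht : t ∈ Ioo 0 T) :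
    HasDerivAt (YY μ β γ R ρ u)
      (-2 * wI R (fun r => ρ r t * UD u r t ^ 2)
        - 2 * wI R (fun r => ρ r t * UD u r t * (u r t * wq u r t))
        + wI R (fun r => -2 * FF μ β γ ρ u r t * (dr u r t + wq u r t) ^ 2
            + (dr u r t + wq u r t) ^ 3 * (2 * μ + ρ r t ^ β - β * ρ r t ^ β)
            + 2 * (γ - 1) * ρ r t ^ γ * (dr u r t + wq u r t) ^ 2)) t := by
  have ht' : t ∈ Icc 0 T := ⟨ht.1.le, ht.2.le⟩
  have hβ := h.hβ
  have hγ := h.hγ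
  have c1 := h.sr.c2
  have c2 := h.su.c2
  have c3 := h.sr.sdr.c2
  have c4 := h.su.sdr.c2
  have c5 := h.sr.sdt.c2
  have c6 := h.su.sdt.c2
  have c7 := wq_c2 h.su
  have c8 := pow_c2 h.sr (p := γ) (by linarith)
  have c9 := pow_c2 h.sr (p := γ - 1) (by linarith)
  have c10 := pow_c2 h.sr (p := β) (by linarith)
  have c11 := pow_c2 h.sr (p := β - 1) (by linarith)
  have c12 := h.su.sdr.sdt.c2
  have d1 := slice c1 t
  have d2 := slice c2 t
  have d3 := slice c3 t
  have d4 := slice c4 t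
  have d5 := slice c5 t
  have d6 := slice c6 t
  have d7 := slice c7 t
  have d8 := slice (f := fun r t => ρ r t ^ γ) c8 t
  have d9 := slice (f := fun r t => ρ r t ^ (γ - 1)) c9 t
  have d10 := slice (f := fun r t => ρ r t ^ β) c10 t
  have d11 := slice (f := fun r t => ρ r t ^ (β - 1)) c11 t
  have d12 := slice c12 t
  have dF : Continuous (fun r => FF μ β γ ρ u r t) := by unfold FF; fun_prop
  have dU : Continuous (fun r => UD u r t) := by unfold UD; fun_prop
  have key := diffint (R := R) (T := T) h.hR
    (G := fun r t => ((2 * μ + ρ r t ^ β) * (dr u r t + wq u r t) ^ 2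
      - 2 * ρ r t ^ γ * (dr u r t + wq u r t)) * r)
    (Gt := fun r t => (dt ρ r t * β * ρ r t ^ (β - 1) * (dr u r t + wq u r t) ^ 2
      - 2 * (dt ρ r t * γ * ρ r t ^ (γ - 1)) * (dr u r t + wq u r t)) * r
      + 2 * ((2 * μ + ρ r t ^ β) * (dr u r t + wq u r t) - ρ r t ^ γ)
        * (r * dt (dr u) r t + dt u r t))
    (by simp only [Function.uncurry_def]; fun_prop) (by simp only [Function.uncurry_def]; fun_prop)
    (by
      intro r hr t ht
      have hV := h.V_t hr ht
      have h1 := ((((pow_t h.sr h.hβ.le r t).const_add (2 * μ)).fun_mul (hV.fun_pow 2)).fun_sub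
        (((pow_t h.sr h.hγ.le r t).const_mul 2).fun_mul hV)).mul_const r
      refine h1.congr_deriv ?_
      have hr0 := hr.1.ne'
      simp only [Nat.cast_ofNat, Nat.add_one_sub_one, pow_one]
      field_simp
      ring) t ht
  have e := ftc (R := R) (h := fun r => 2 * FF μ β γ ρ u r t * (r * UD u r t)
      - r * u r t * ((2 * μ + ρ r t ^ β) * (dr u r t + wq u r t) ^ 2
        - 2 * ρ r t ^ γ * (dr u r t + wq u r t)) + 2 * FF μ β γ ρ u r t * u r t ^ 2)
    (k := fun r => ((dt ρ r t * β * ρ r t ^ (β - 1) * (dr u r t + wq u r t) ^ 2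
      - 2 * (dt ρ r t * γ * ρ r t ^ (γ - 1)) * (dr u r t + wq u r t)) * r
      + 2 * ((2 * μ + ρ r t ^ β) * (dr u r t + wq u r t) - ρ r t ^ γ)
        * (r * dt (dr u) r t + dt u r t))
      - (-2 * (ρ r t * UD u r t ^ 2 * r)
        - 2 * (ρ r t * UD u r t * (u r t * wq u r t) * r)
        + (-2 * FF μ β γ ρ u r t * (dr u r t + wq u r t) ^ 2
            + (dr u r t + wq u r t) ^ 3 * (2 * μ + ρ r t ^ β - β * ρ r t ^ β)
            + 2 * (γ - 1) * ρ r t ^ γ * (dr u r t + wq u r t) ^ 2) * r))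
    (by fun_prop) (by fun_prop) le_rfl h.hR.le le_rfl (by
      intro r hr
      have h0 := ((hasDerivAt_id r).fun_mul (h.su.hr r t))
      have hV := h.V_r hr ht'
      have hF := (h.F_r hr ht').const_mul 2
      have hU : HasDerivAt (fun s => UD u s t)
        (dr (dt u) r t + (dr u r t * dr u r t + u r t * dr (dr u) r t)) r :=
        (h.su.sdt.hr r t).fun_add ((h.su.hr r t).fun_mul (h.su.sdr.hr r t))
      have hφ := (((pow_r h.sr h.hβ.le r t).const_add (2 * μ)).fun_mul (hV.fun_pow 2)).fun_sub
        (((pow_r h.sr h.hγ.le r t).const_mul 2).fun_mul hV)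
      have h1 := ((hF.fun_mul ((hasDerivAt_id r).fun_mul hU)).fun_sub (h0.fun_mul hφ)).fun_add
        (hF.fun_mul ((h.su.hr r t).fun_pow 2))
      refine h1.congr_deriv ?_
      have hr0 := hr.1.ne'
      simp only [Nat.cast_ofNat, Nat.add_one_sub_one, pow_one, id_eq, FF, UD, h.mass' hr ht',
        h.uw ht' r, ← h.su.comm]
      rw [h.pw (p := γ) hr ht', h.pw (p := β) hr ht']
      field_simp
      ring)
  rw [intervalIntegral.integral_sub (by apply Continuous.intervalIntegrable; fun_prop)
    (by apply Continuous.intervalIntegrable; fun_prop),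
    intervalIntegral.integral_add (f := fun r => -2 * (ρ r t * UD u r t ^ 2 * r)
        - 2 * (ρ r t * UD u r t * (u r t * wq u r t) * r))
    (by apply Continuous.intervalIntegrable; fun_prop)
    (by apply Continuous.intervalIntegrable; fun_prop),
    intervalIntegral.integral_sub (f := fun r => -2 * (ρ r t * UD u r t ^ 2 * r))
    (by apply Continuous.intervalIntegrable; fun_prop)
    (by apply Continuous.intervalIntegrable; fun_prop),
    intervalIntegral.integral_const_mul, intervalIntegral.integral_const_mul] at e
  refine key.congr_deriv ?_
  unfold wI
  have uU : UD u R t = 0 := by rw [UD, h.utR ht, h.bcR t ht']; ring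
  rw [h.bcR t ht', h.bc0 t ht', uU] at e
  linear_combination e

end Evolution2

section Final
variable {μ β γ R T : ℝ} {ρ u : ℝ → ℝ → ℝ}

lemma RadialSolution.DD_nonneg (h : RadialSolution μ β γ R T ρ u) {t : ℝ} (ht : t ∈ Icc 0 T) :
    0 ≤ DD μ β R ρ u t := by
  have hβ := h.hβ
  have hμ := h.hμ
  have d4 := slice h.su.sdr.c2 t
  have d7 := slice (wq_c2 h.su) t
  have d10 := slice (f := fun r t => ρ r t ^ β) (pow_c2 h.sr (p := β) (by linarith)) t
  refine wI_nonneg h.hR (by fun_prop) (fun r hr => ?_)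
  have := h.ρ_pos r ⟨hr.1.le, hr.2.le⟩ t ht
  positivity

lemma RadialSolution.EE_cont (h : RadialSolution μ β γ R T ρ u) : Continuous (EE γ R ρ u) := by
  have hγ := h.hγ
  have c1 := h.sr.c2
  have c2 := h.su.c2
  have c8 := pow_c2 h.sr (p := γ) (by linarith)
  exact int_cont (G := fun r t => (ρ r t * u r t ^ 2 / 2 + ρ r t ^ γ / (γ - 1)) * r)
    (by simp only [Function.uncurry_def]; fun_prop) R

lemma RadialSolution.YY_cont (h : RadialSolution μ β γ R T ρ u) :
    Continuous (YY μ β γ R ρ u) := by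
  have hγ := h.hγ
  have hβ := h.hβ
  have c4 := h.su.sdr.c2
  have c7 := wq_c2 h.su
  have c8 := pow_c2 h.sr (p := γ) (by linarith)
  have c10 := pow_c2 h.sr (p := β) (by linarith)
  exact int_cont (G := fun r t => ((2 * μ + ρ r t ^ β) * (dr u r t + wq u r t) ^ 2
    - 2 * ρ r t ^ γ * (dr u r t + wq u r t)) * r)
    (by simp only [Function.uncurry_def]; fun_prop) R

lemma anti_aux {f f' : ℝ → ℝ} (hf : ContinuousOn f (Icc 0 T))
    (hd : ∀ t ∈ Ioo 0 T, HasDerivAt f (f' t) t) (hn : ∀ t ∈ Ioo 0 T, f' t ≤ 0) {t : ℝ}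
    (ht : t ∈ Icc 0 T) : f t ≤ f 0 := by
  have h1 : AntitoneOn f (Icc 0 T) := by
    apply antitoneOn_of_deriv_nonpos (convex_Icc 0 T) hf
    · rw [interior_Icc]
      exact fun t ht => (hd t ht).differentiableAt.differentiableWithinAt
    · rw [interior_Icc]
      intro t ht
      rw [(hd t ht).deriv]; exact hn t ht
  exact h1 ⟨le_rfl, ht.1.trans ht.2⟩ ht ht.1

lemma RadialSolution.E_le (h : RadialSolution μ β γ R T ρ u) {t : ℝ} (ht : t ∈ Icc 0 T) :
    EE γ R ρ u t ≤ EE γ R ρ u 0 :=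
  anti_aux h.EE_cont.continuousOn (fun _ ht => h.E_t ht)
    (fun t ht => by have := h.DD_nonneg ⟨ht.1.le, ht.2.le⟩; linarith) ht

lemma RadialSolution.EE_nonneg (h : RadialSolution μ β γ R T ρ u) {t : ℝ} (ht : t ∈ Icc 0 T) :
    0 ≤ EE γ R ρ u t := by
  have hγ : 0 < γ - 1 := by linarith [h.hγ]
  have d1 := slice h.sr.c2 t
  have d2 := slice h.su.c2 t
  have d8 := slice (f := fun r t => ρ r t ^ γ) (pow_c2 h.sr (p := γ) (by linarith)) t
  refine wI_nonneg h.hR (by fun_prop) (fun r hr => ?_)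
  have := h.ρ_pos r ⟨hr.1.le, hr.2.le⟩ t ht
  positivity

lemma RadialSolution.P_le (h : RadialSolution μ β γ R T ρ u) {t : ℝ} (ht : t ∈ Icc 0 T) :
    wI R (fun r => ρ r t ^ γ) ≤ (γ - 1) * EE γ R ρ u 0 := by
  have hγ : 0 < γ - 1 := by linarith [h.hγ]
  have d1 := slice h.sr.c2 t
  have d2 := slice h.su.c2 t
  have d8 := slice (f := fun r t => ρ r t ^ γ) (pow_c2 h.sr (p := γ) (by linarith)) t
  calc wI R (fun r => ρ r t ^ γ) ≤ (γ - 1) * EE γ R ρ u t := by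
        unfold EE
        rw [← wI_smul]
        refine wI_mono h.hR (by fun_prop) (by fun_prop) (fun r hr => ?_)
        have := h.ρ_pos r ⟨hr.1.le, hr.2.le⟩ t ht
        have e : (γ - 1) * (ρ r t * u r t ^ 2 / 2 + ρ r t ^ γ / (γ - 1))
          = (γ - 1) * (ρ r t * u r t ^ 2 / 2) + ρ r t ^ γ := by field_simp
        rw [e]
        have : 0 ≤ (γ - 1) * (ρ r t * u r t ^ 2 / 2) := by positivity
        linarith
    _ ≤ _ := by have := h.E_le ht; gcongr

lemma RadialSolution.E0_le (h : RadialSolution μ β γ R T ρ u) {N1 N2 : ℝ} (hN1 : 0 ≤ N1)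
    (h1 : ∀ r ∈ Icc (0:ℝ) R, ρ r 0 ≤ N1)
    (h2 : wI R (fun r => u r 0 ^ 2 + (dr u r 0 ^ 2 + wq u r 0 ^ 2)) ≤ N2) :
    EE γ R ρ u 0 ≤ N1 / 2 * N2 + N1 ^ γ / (γ - 1) * (R ^ 2 / 2) := by
  have hγ : 0 < γ - 1 := by linarith [h.hγ]
  have h0 : (0:ℝ) ∈ Icc 0 T := ⟨le_rfl, h.hT.le⟩
  have d1 := slice h.sr.c2 0
  have d2 := slice h.su.c2 0
  have d4 := slice h.su.sdr.c2 0
  have d7 := slice (wq_c2 h.su) 0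
  have d8 := slice (f := fun r t => ρ r t ^ γ) (pow_c2 h.sr (p := γ) (by linarith)) 0
  calc EE γ R ρ u 0 ≤ wI R (fun r => N1 / 2 * (u r 0 ^ 2 + (dr u r 0 ^ 2 + wq u r 0 ^ 2))
          + N1 ^ γ / (γ - 1)) := by
        refine wI_mono h.hR (by fun_prop) (by fun_prop) (fun r hr => ?_)
        have hp := h.ρ_pos r ⟨hr.1.le, hr.2.le⟩ 0 h0
        have hle := h1 r ⟨hr.1.le, hr.2.le⟩
        have a1 : ρ r 0 ^ γ ≤ N1 ^ γ := Real.rpow_le_rpow hp.le hle (by linarith)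
        have a2 : ρ r 0 ^ γ / (γ - 1) ≤ N1 ^ γ / (γ - 1) := by gcongr
        have a3 : ρ r 0 * u r 0 ^ 2 / 2 ≤ N1 * u r 0 ^ 2 / 2 := by gcongr
        have a4 : 0 ≤ N1 / 2 * (dr u r 0 ^ 2 + wq u r 0 ^ 2) := by positivity
        linarith
    _ = N1 / 2 * wI R (fun r => u r 0 ^ 2 + (dr u r 0 ^ 2 + wq u r 0 ^ 2))
          + N1 ^ γ / (γ - 1) * (R ^ 2 / 2) := by
        rw [wI_add (by fun_prop) (by fun_prop), wI_smul, wI_const]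
    _ ≤ _ := by gcongr

lemma RadialSolution.g_cont (h : RadialSolution μ β γ R T ρ u) (t : ℝ) :
    Continuous (fun r => 1 / (2 * μ + |ρ r t ^ β|)) := by
  have hβ := h.hβ
  have hμ := h.hμ
  have d10 := slice (f := fun r t => ρ r t ^ β) (pow_c2 h.sr (p := β) (by linarith)) t
  exact continuous_const.div (by fun_prop) (fun r => by positivity)

/-- lower bound of the weight -/
lemma RadialSolution.g_low (h : RadialSolution μ β γ R T ρ u) {E0 X : ℝ}
    (hE : EE γ R ρ u 0 ≤ E0) (hX : X = 4 * ((γ - 1) * E0) / R ^ 2 + 1) {t : ℝ}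
    (ht : t ∈ Icc 0 T) :
    1 / (2 * μ + (X ^ (1 / γ)) ^ β) * (R ^ 2 / 4) ≤ wI R (fun r => 1 / (2 * μ + |ρ r t ^ β|)) := by
  have hβ := h.hβ
  have hμ := h.hμ
  have hR := h.hR
  have hγ : 0 < γ - 1 := by linarith [h.hγ]
  have hE00 := h.EE_nonneg (t := 0) ⟨le_rfl, h.hT.le⟩
  have hE0 : 0 ≤ E0 := hE00.trans hE
  have hX1 : 1 ≤ X := by
    have : 0 ≤ 4 * ((γ - 1) * E0) / R ^ 2 := by positivity
    linarith
  have hX0 : 0 < X := by linarith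
  set K := X ^ (1 / γ) with hK
  have hK0 : 0 < K := by positivity
  have hKγ : K ^ γ = X := by
    rw [hK, ← Real.rpow_mul hX0.le]; rw [one_div_mul_cancel (by linarith), Real.rpow_one]
  set gK := 1 / (2 * μ + K ^ β) with hgK
  have hgK0 : 0 < gK := by positivity
  have d8 := slice (f := fun r t => ρ r t ^ γ) (pow_c2 h.sr (p := γ) (by linarith)) t
  have hP := (h.P_le ht).trans (mul_le_mul_of_nonneg_left hE hγ.le)
  have step : wI R (fun r => gK + (-(gK / X)) * ρ r t ^ γ)
      ≤ wI R (fun r => 1 / (2 * μ + |ρ r t ^ β|)) := by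
    refine wI_mono h.hR (by fun_prop) (h.g_cont t) (fun r hr => ?_)
    have hp := h.ρ_pos r ⟨hr.1.le, hr.2.le⟩ t ht
    have hpb : 0 < ρ r t ^ β := by positivity
    rw [abs_of_pos hpb]
    rcases le_total (ρ r t) K with hle | hle
    · have a1 : ρ r t ^ β ≤ K ^ β := Real.rpow_le_rpow hp.le hle (by linarith)
      have a2 : gK ≤ 1 / (2 * μ + ρ r t ^ β) := by
        rw [hgK]; gcongr
      have a3 : 0 ≤ gK / X * ρ r t ^ γ := by positivity
      linarith
    · have a1 : K ^ γ ≤ ρ r t ^ γ := Real.rpow_le_rpow hK0.le hle (by linarith)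
      rw [hKγ] at a1
      have a2 : gK / X * X ≤ gK / X * ρ r t ^ γ := by gcongr
      rw [div_mul_cancel₀ _ hX0.ne'] at a2
      have a3 : 0 ≤ 1 / (2 * μ + ρ r t ^ β) := by positivity
      linarith
  refine le_trans ?_ step
  rw [wI_add (by fun_prop) (by fun_prop), wI_smul, wI_const]
  have b1 : gK / X * wI R (fun r => ρ r t ^ γ) ≤ gK / X * ((γ - 1) * E0) := by gcongr
  have b2 : (γ - 1) * E0 ≤ X * (R ^ 2 / 4) := by
    have : X * (R ^ 2 / 4) = (γ - 1) * E0 + R ^ 2 / 4 := by rw [hX]; field_simp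
    rw [this]; have : 0 ≤ R ^ 2 / 4 := by positivity
    linarith
  have b3 : gK / X * ((γ - 1) * E0) ≤ gK / X * (X * (R ^ 2 / 4)) := by gcongr
  have b4 : gK / X * (X * (R ^ 2 / 4)) = gK * (R ^ 2 / 4) := by field_simp
  linarith

end Final

section Final2
variable {μ β γ R T : ℝ} {ρ u : ℝ → ℝ → ℝ}

lemma RadialSolution.y_low (h : RadialSolution μ β γ R T ρ u) {p : ℝ} {t : ℝ}
    (ht : t ∈ Icc 0 T) (hp : ∀ r ∈ Ioo 0 R, ρ r t ^ γ ≤ p) :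
    wI R (fun r => FF μ β γ ρ u r t ^ 2 * (1 / (2 * μ + |ρ r t ^ β|))) + p ^ 2
      ≤ YY μ β γ R ρ u t + (R ^ 2 / (4 * μ) + 1) * p ^ 2 := by
  have hβ := h.hβ
  have hμ := h.hμ
  have hγ := h.hγ
  have d4 := slice h.su.sdr.c2 t
  have d7 := slice (wq_c2 h.su) t
  have d8 := slice (f := fun r t => ρ r t ^ γ) (pow_c2 h.sr (p := γ) (by linarith)) t
  have d10 := slice (f := fun r t => ρ r t ^ β) (pow_c2 h.sr (p := β) (by linarith)) t
  have dg := h.g_cont t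
  have dF : Continuous (fun r => FF μ β γ ρ u r t) := by unfold FF; fun_prop
  have h1 : wI R (fun r => FF μ β γ ρ u r t ^ 2 * (1 / (2 * μ + |ρ r t ^ β|)))
      ≤ wI R (fun r => ((2 * μ + ρ r t ^ β) * (dr u r t + wq u r t) ^ 2
        - 2 * ρ r t ^ γ * (dr u r t + wq u r t)) + p ^ 2 / (2 * μ)) := by
    refine wI_mono h.hR (by fun_prop) (by fun_prop) (fun r hr => ?_)
    have hpos := h.ρ_pos r ⟨hr.1.le, hr.2.le⟩ t ht
    have hpb : 0 < ρ r t ^ β := by positivity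
    have hpg : 0 < ρ r t ^ γ := by positivity
    rw [abs_of_pos hpb]
    have e : FF μ β γ ρ u r t ^ 2 * (1 / (2 * μ + ρ r t ^ β))
        = ((2 * μ + ρ r t ^ β) * (dr u r t + wq u r t) ^ 2
        - 2 * ρ r t ^ γ * (dr u r t + wq u r t)) + (ρ r t ^ γ) ^ 2 / (2 * μ + ρ r t ^ β) := by
      unfold FF
      generalize ρ r t ^ γ = P at *
      generalize ρ r t ^ β = l at *
      have : 2 * μ + l ≠ 0 := by positivity
      field_simp
      ring
    rw [e]
    have a1 := hp r hr
    have : (ρ r t ^ γ) ^ 2 / (2 * μ + ρ r t ^ β) ≤ p ^ 2 / (2 * μ) := by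
      gcongr; linarith
    linarith
  rw [wI_add (by fun_prop) (by fun_prop), wI_const] at h1
  have h2 : p ^ 2 / (2 * μ) * (R ^ 2 / 2) = R ^ 2 / (4 * μ) * p ^ 2 := by field_simp; ring
  unfold YY
  linarith

lemma RadialSolution.y0_up (h : RadialSolution μ β γ R T ρ u) {p N1 N2 : ℝ}
    (hp1 : 1 ≤ p) (hp : ∀ r ∈ Ioo 0 R, ρ r 0 ^ γ ≤ p) (hN2 : 0 ≤ N2)
    (h1 : ∀ r ∈ Icc (0:ℝ) R, ρ r 0 ≤ N1) (hN1 : 0 ≤ N1)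
    (h2 : wI R (fun r => u r 0 ^ 2 + (dr u r 0 ^ 2 + wq u r 0 ^ 2)) ≤ N2) :
    YY μ β γ R ρ u 0 + (R ^ 2 / (4 * μ) + 1) * p ^ 2
      ≤ (4 * (2 * μ + N1 ^ β) * N2 + 2 * (R ^ 2 / (4 * μ) + 1)) * p ^ 2 := by
  have hβ := h.hβ
  have hμ := h.hμ
  have hγ := h.hγ
  have h0 : (0:ℝ) ∈ Icc 0 T := ⟨le_rfl, h.hT.le⟩
  have d2 := slice h.su.c2 0
  have d4 := slice h.su.sdr.c2 0
  have d7 := slice (wq_c2 h.su) 0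
  have d8 := slice (f := fun r t => ρ r t ^ γ) (pow_c2 h.sr (p := γ) (by linarith)) 0
  have d10 := slice (f := fun r t => ρ r t ^ β) (pow_c2 h.sr (p := β) (by linarith)) 0
  have hNb : 0 ≤ N1 ^ β := by positivity
  have h3 : YY μ β γ R ρ u 0 ≤ wI R (fun r => (4 * (2 * μ + N1 ^ β))
      * (u r 0 ^ 2 + (dr u r 0 ^ 2 + wq u r 0 ^ 2)) + p ^ 2 / (2 * μ)) := by
    refine wI_mono h.hR (by fun_prop) (by fun_prop) (fun r hr => ?_)
    have hpos := h.ρ_pos r ⟨hr.1.le, hr.2.le⟩ 0 h0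
    have hpb : 0 < ρ r 0 ^ β := by positivity
    have hpg : 0 < ρ r 0 ^ γ := by positivity
    have a1 := hp r hr
    have a2 : ρ r 0 ^ β ≤ N1 ^ β :=
      Real.rpow_le_rpow hpos.le (h1 r ⟨hr.1.le, hr.2.le⟩) (by linarith)
    have a3 : (ρ r 0 ^ γ) ^ 2 / (2 * μ + ρ r 0 ^ β) ≤ p ^ 2 / (2 * μ) := by
      gcongr; linarith
    set V := dr u r 0 + wq u r 0 with hV
    have a4 : - 2 * ρ r 0 ^ γ * V ≤ (2 * μ + ρ r 0 ^ β) * V ^ 2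
        + (ρ r 0 ^ γ) ^ 2 / (2 * μ + ρ r 0 ^ β) := by
      have hd : 0 < 2 * μ + ρ r 0 ^ β := by positivity
      have e : (2 * μ + ρ r 0 ^ β) * V ^ 2
        + (ρ r 0 ^ γ) ^ 2 / (2 * μ + ρ r 0 ^ β) + 2 * ρ r 0 ^ γ * V
        = ((2 * μ + ρ r 0 ^ β) * V + ρ r 0 ^ γ) ^ 2 / (2 * μ + ρ r 0 ^ β) := by
        generalize ρ r 0 ^ γ = P at *
        generalize ρ r 0 ^ β = l at *
        have : 2 * μ + l ≠ 0 := by positivity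
        field_simp
        ring
      have : 0 ≤ ((2 * μ + ρ r 0 ^ β) * V + ρ r 0 ^ γ) ^ 2 / (2 * μ + ρ r 0 ^ β) := by positivity
      linarith
    have a5 : V ^ 2 ≤ 2 * (u r 0 ^ 2 + (dr u r 0 ^ 2 + wq u r 0 ^ 2)) := by
      have e : 2 * (dr u r 0 ^ 2 + wq u r 0 ^ 2) = V ^ 2 + (dr u r 0 - wq u r 0) ^ 2 := by
        rw [hV]; ring
      have := sq_nonneg (dr u r 0 - wq u r 0)
      have := sq_nonneg (u r 0)
      linarith
    have a6 : (2 * μ + ρ r 0 ^ β) * V ^ 2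
        ≤ (2 * μ + N1 ^ β) * (2 * (u r 0 ^ 2 + (dr u r 0 ^ 2 + wq u r 0 ^ 2))) := by gcongr
    linarith
  rw [wI_add (by fun_prop) (by fun_prop), wI_const, wI_smul] at h3
  have e2 : p ^ 2 / (2 * μ) * (R ^ 2 / 2) = R ^ 2 / (4 * μ) * p ^ 2 := by field_simp; ring
  have b1 : 4 * (2 * μ + N1 ^ β) * wI R (fun r => u r 0 ^ 2 + (dr u r 0 ^ 2 + wq u r 0 ^ 2))
    ≤ 4 * (2 * μ + N1 ^ β) * N2 := by gcongr
  have b2 : 4 * (2 * μ + N1 ^ β) * N2 * 1 ≤ 4 * (2 * μ + N1 ^ β) * N2 * p ^ 2 := by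
    gcongr; exact one_le_pow₀ hp1
  have b3 := sq_nonneg p
  linarith

lemma RadialSolution.gronwall (h : RadialSolution μ β γ R T ρ u) {c K : ℝ} (hc : 0 ≤ c)
    (hy : ∀ t ∈ Icc 0 T, 1 ≤ YY μ β γ R ρ u t + K)
    (hd : ∀ t ∈ Ioo 0 T, -2 * wI R (fun r => ρ r t * UD u r t ^ 2)
        - 2 * wI R (fun r => ρ r t * UD u r t * (u r t * wq u r t))
        + wI R (fun r => -2 * FF μ β γ ρ u r t * (dr u r t + wq u r t) ^ 2
            + (dr u r t + wq u r t) ^ 3 * (2 * μ + ρ r t ^ β - β * ρ r t ^ β)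
            + 2 * (γ - 1) * ρ r t ^ γ * (dr u r t + wq u r t) ^ 2)
        ≤ c * DD μ β R ρ u t * (YY μ β γ R ρ u t + K)) {t : ℝ} (ht : t ∈ Icc 0 T) :
    Real.log (YY μ β γ R ρ u t + K) ≤ Real.log (YY μ β γ R ρ u 0 + K) + c * EE γ R ρ u 0 := by
  have hE := h.EE_nonneg ht
  have hcE : 0 ≤ c * EE γ R ρ u t := by positivity
  have key := anti_aux (T := T) (f := fun t => Real.log (YY μ β γ R ρ u t + K) + c * EE γ R ρ u t)
    (by
      refine ContinuousOn.add ?_ (h.EE_cont.continuousOn.const_mul c |> fun x => x)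
      exact ContinuousOn.log (h.YY_cont.continuousOn.add continuousOn_const)
        (fun t ht => by have := hy t ht; positivity))
    (fun t ht => (((h.Y_t ht).add_const K).log
      (by have := hy t ⟨ht.1.le, ht.2.le⟩; positivity)).fun_add ((h.E_t ht).const_mul c))
    (fun t ht => by
      have h1 := hy t ⟨ht.1.le, ht.2.le⟩
      have h2 := hd t ht
      have h3 := (div_le_iff₀ (by linarith : 0 < YY μ β γ R ρ u t + K)).2 h2
      linarith) ht
  linarith

end Final2

section Conv
variable {μ β γ R T : ℝ} {ρ u : ℝ → ℝ → ℝ}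

lemma wI_set {R : ℝ} (hR : 0 < R) (f g : ℝ → ℝ) (h : ∀ r ∈ Ioo 0 R, f r = g r * r) :
    (∫ r in Ioo (0:ℝ) R, f r) = wI R g := by
  unfold wI
  rw [intervalIntegral.integral_of_le hR.le, integral_Ioc_eq_integral_Ioo]
  exact setIntegral_congr_fun measurableSet_Ioo h

lemma RadialSolution.RT_bd (h : RadialSolution μ β γ R T ρ u) {RT : ℝ}
    (hRT : RT = 1 + sSup (Set.image2 ρ (Icc 0 R) (Icc 0 T))) :
    ∀ r ∈ Icc 0 R, ∀ t ∈ Icc 0 T, ρ r t ≤ RT - 1 := by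
  intro r hr t ht
  have hc : IsCompact (Set.image2 ρ (Icc 0 R) (Icc 0 T)) := by
    rw [← Set.image_uncurry_prod]
    exact (isCompact_Icc.prod isCompact_Icc).image h.sr.cont
  have := le_csSup hc.bddAbove (Set.mem_image2_of_mem hr ht)
  linarith

lemma k_exists {μ β α RT : ℝ} (hμ : 0 < μ) (hβ : 1 < β) (hα : 0 < α) (hRT : 1 ≤ RT) {m : ℕ}
    (hm : 1 ≤ (m + 1) * α) :
    ∃ k : ℝ, 1 ≤ k ∧ k ^ 2 = (2 * μ + 1) * RT ^ (α * β) ∧ 2 * μ + RT ^ β ≤ (k ^ 2) ^ (m + 1) := by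
  have h0 : 0 < RT := by linarith
  have h1 : 1 ≤ RT ^ (α * β) := Real.one_le_rpow hRT (by positivity)
  have h2 : 1 ≤ (2 * μ + 1) * RT ^ (α * β) := by
    calc (1:ℝ) = 1 * 1 := by norm_num
      _ ≤ (2 * μ + 1) * RT ^ (α * β) := by gcongr; linarith
  refine ⟨Real.sqrt ((2 * μ + 1) * RT ^ (α * β)), ?_, Real.sq_sqrt (by linarith), ?_⟩
  · rw [Real.one_le_sqrt]; exact h2
  · rw [Real.sq_sqrt (by linarith), mul_pow]
    have h3 : RT ^ β ≤ (RT ^ (α * β)) ^ (m + 1) := by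
      rw [← Real.rpow_natCast, ← Real.rpow_mul h0.le]
      apply Real.rpow_le_rpow_of_exponent_le hRT
      push_cast
      calc β = 1 * β := by ring
        _ ≤ (m + 1) * α * β := by gcongr
        _ = _ := by ring
    have h4 : 2 * μ + 1 ≤ (2 * μ + 1) ^ (m + 1) := le_self_pow₀ (by linarith) (by simp)
    have h5 : 1 ≤ RT ^ β := Real.one_le_rpow hRT (by linarith)
    have h6 : 0 ≤ 2 * μ * (RT ^ β - 1) := mul_nonneg (by positivity) (by linarith)
    calc 2 * μ + RT ^ β ≤ (2 * μ + 1) * RT ^ β := by linarith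
      _ ≤ _ := by gcongr

end Conv


/-- **Time-uniform estimate of the effective viscous flux.** With
`R_T = 1 + sup_{[0,R]×[0,T]} ρ`, for any `α ∈ (0,1)` there is a constant `C(α)` depending
only on `α, μ, β, γ, ‖ρ₀‖_{L^∞}, ‖u₀‖_{H¹}` (and `Ω`), independent of `T`, such that
`sup_t log(e + ∫_Ω F²/(2μ+λ) dx + ∫_Ω (2μ+λ)|div u|² dx) ≤ C(α)(R_T^{αβ+1} + R_T^{γ−2β+1})`. -/
theorem flux_log_estimate
    (μ β γ R α M₁ M₂ : ℝ)
    (hμ : 0 < μ) (hβ : 1 < β) (hγ : 1 < γ) (hR : 0 < R) (hα : α ∈ Ioo (0:ℝ) 1) :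
    ∃ C > 0, ∀ T > 0, ∀ (ρ u : ℝ → ℝ → ℝ) (RT : ℝ),
      RadialSolution μ β γ R T ρ u →
      (∀ r ∈ Icc (0:ℝ) R, ρ r 0 ≤ M₁) →
      (2 * Real.pi * (∫ r in Ioo (0:ℝ) R, ((u r 0) ^ 2 + gradSq u r 0) * r) ≤ M₂) →
      RT = 1 + sSup (Set.image2 ρ (Icc 0 R) (Icc 0 T)) →
      ∀ t ∈ Icc (0:ℝ) T,
        Real.log (Real.exp 1
            + 2 * Real.pi * (∫ r in Ioo (0:ℝ) R,
                (flux μ β γ ρ u r t) ^ 2 / (2 * μ + ρ r t ^ β) * r)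
            + 2 * Real.pi * (∫ r in Ioo (0:ℝ) R,
                (2 * μ + ρ r t ^ β) * (rdiv u r t) ^ 2 * r))
          ≤ C * (RT ^ (α * β + 1) + RT ^ (γ - 2 * β + 1)) := by
  obtain ⟨hα0, hα1⟩ := hα
  set N1 : ℝ := |M₁| + 1 with hN1
  set N2 : ℝ := |M₂| / (2 * Real.pi) with hN2
  have hN1p : 0 < N1 := by positivity
  have hN2p : 0 ≤ N2 := by positivity
  have hγ1 : 0 < γ - 1 := by linarith
  set E0 : ℝ := N1 / 2 * N2 + N1 ^ γ / (γ - 1) * (R ^ 2 / 2) with hE0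
  have hE0p : 0 ≤ E0 := by positivity
  obtain ⟨X, hX⟩ : ∃ X : ℝ, X = 4 * ((γ - 1) * E0) / R ^ 2 + 1 := ⟨_, rfl⟩
  have hXp : 0 < X := by rw [hX]; positivity
  obtain ⟨c0, hc0⟩ : ∃ c0 : ℝ, c0 = 1 / (2 * μ + (X ^ (1 / γ)) ^ β) * (R ^ 2 / 4) := ⟨_, rfl⟩
  have hc0p : 0 < c0 := by rw [hc0]; positivity
  obtain ⟨m, hm⟩ : ∃ m : ℕ, 1 ≤ ((m:ℝ) + 1) * α := by
    obtain ⟨m, hm⟩ := exists_nat_ge (1 / α)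
    refine ⟨m, ?_⟩
    rw [div_le_iff₀ hα0] at hm
    linarith
  obtain ⟨C, hC, hrhs⟩ := rhs_bound hR hμ hβ hγ (Real.sqrt_pos.2 hc0p) m
  set K : ℝ := R ^ 2 / (4 * μ) + 1 with hK
  set Kc : ℝ := 4 * (2 * μ + N1 ^ β) * N2 + 2 * K with hKc
  have hKcp : 0 < Kc := by positivity
  set C' : ℝ := Real.exp 1 + 2 * Real.pi + 2 * Real.pi * C with hC'
  have hC'p : 0 < C' := by positivity
  refine ⟨|Real.log C'| + |Real.log Kc| + 2 * γ + C * (2 * μ + 1) * E0 + 1, by positivity, ?_⟩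
  intro T hT ρ u RT h hM1 hM2 hRT
  have hbd := h.RT_bd hRT
  have h0T : (0:ℝ) ∈ Icc 0 T := ⟨le_rfl, hT.le⟩
  have hRT1 : 1 ≤ RT := by
    have a1 := hbd 0 ⟨le_rfl, hR.le⟩ 0 h0T
    have a2 := h.ρ_pos 0 ⟨le_rfl, hR.le⟩ 0 h0T
    linarith
  have hRT0 : 0 < RT := by linarith
  have hρ1 : ∀ r ∈ Icc (0:ℝ) R, ρ r 0 ≤ N1 := fun r hr =>
    (hM1 r hr).trans (by have := le_abs_self M₁; linarith)
  have hu2 : wI R (fun r => u r 0 ^ 2 + (dr u r 0 ^ 2 + wq u r 0 ^ 2)) ≤ N2 := by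
    have e := wI_set hR (fun r => ((u r 0) ^ 2 + gradSq u r 0) * r)
      (fun r => u r 0 ^ 2 + (dr u r 0 ^ 2 + wq u r 0 ^ 2)) (by
        intro r hr
        simp only [gradSq, (h.su.hr r 0).deriv, h.wdiv h0T hr.1.ne'])
    rw [e] at hM2
    rw [hN2, le_div_iff₀ (by positivity)]
    have := le_abs_self M₂
    linarith
  have hE := h.E0_le hN1p.le hρ1 hu2
  rw [← hE0] at hE
  obtain ⟨k, hk1, hk2, hkL⟩ := k_exists hμ hβ hα0 hRT1 hm
  obtain ⟨p, hp⟩ : ∃ p : ℝ, p = RT ^ γ := ⟨_, rfl⟩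
  have hp1 : 1 ≤ p := by rw [hp]; exact Real.one_le_rpow hRT1 (by linarith)
  have hPp : ∀ t ∈ Icc 0 T, ∀ r ∈ Ioo 0 R, 0 ≤ ρ r t ^ γ ∧ ρ r t ^ γ ≤ p := by
    intro t ht r hr
    have hr' : r ∈ Icc 0 R := ⟨hr.1.le, hr.2.le⟩
    have a1 := h.ρ_pos r hr' t ht
    have a2 := hbd r hr' t ht
    refine ⟨by positivity, ?_⟩
    rw [hp]; exact Real.rpow_le_rpow a1.le (by linarith) (by linarith)
  have hy : ∀ t ∈ Icc 0 T, wI R (fun r => FF μ β γ ρ u r t ^ 2 * (1 / (2 * μ + |ρ r t ^ β|)))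
      + p ^ 2 ≤ YY μ β γ R ρ u t + K * p ^ 2 := fun t ht =>
    h.y_low ht (fun r hr => (hPp t ht r hr).2)
  have hFg : ∀ t ∈ Icc 0 T,
      0 ≤ wI R (fun r => FF μ β γ ρ u r t ^ 2 * (1 / (2 * μ + |ρ r t ^ β|))) := by
    intro t ht
    have d4 := slice h.su.sdr.c2 t
    have d7 := slice (wq_c2 h.su) t
    have d8 := slice (f := fun r t => ρ r t ^ γ) (pow_c2 h.sr (p := γ) (by linarith)) t
    have d10 := slice (f := fun r t => ρ r t ^ β) (pow_c2 h.sr (p := β) (by linarith)) t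
    have dg := h.g_cont t
    have dF : Continuous (fun r => FF μ β γ ρ u r t) := by unfold FF; fun_prop
    refine wI_nonneg hR (by fun_prop) (fun r hr => by positivity)
  have hy1 : ∀ t ∈ Icc 0 T, 1 ≤ YY μ β γ R ρ u t + K * p ^ 2 := by
    intro t ht
    have a1 := hy t ht
    have a2 := hFg t ht
    have a3 : 1 ≤ p ^ 2 := one_le_pow₀ hp1
    linarith
  have hmain : ∀ t ∈ Icc 0 T, DD μ β R ρ u t ≤ C * (YY μ β γ R ρ u t + K * p ^ 2) ∧
      -2 * wI R (fun r => ρ r t * UD u r t ^ 2)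
        - 2 * wI R (fun r => ρ r t * UD u r t * (u r t * wq u r t))
        + wI R (fun r => -2 * FF μ β γ ρ u r t * (dr u r t + wq u r t) ^ 2
            + (dr u r t + wq u r t) ^ 3 * (2 * μ + ρ r t ^ β - β * ρ r t ^ β)
            + 2 * (γ - 1) * ρ r t ^ γ * (dr u r t + wq u r t) ^ 2)
        ≤ C * (RT * k ^ 2) * DD μ β R ρ u t * (YY μ β γ R ρ u t + K * p ^ 2) := by
    intro t ht
    have d1 := slice h.sr.c2 t
    have d2 := slice h.su.c2 t
    have d4 := slice h.su.sdr.c2 t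
    have d6 := slice h.su.sdt.c2 t
    have d7 := slice (wq_c2 h.su) t
    have d8 := slice (f := fun r t => ρ r t ^ γ) (pow_c2 h.sr (p := γ) (by linarith)) t
    have d10 := slice (f := fun r t => ρ r t ^ β) (pow_c2 h.sr (p := β) (by linarith)) t
    have dF : Continuous (fun r => FF μ β γ ρ u r t) := by unfold FF; fun_prop
    have dU : Continuous (fun r => UD u r t) := by unfold UD; fun_prop
    have hρt : ∀ r ∈ Ioo 0 R, 0 < ρ r t ∧ ρ r t ≤ RT := by
      intro r hr
      have hr' : r ∈ Icc 0 R := ⟨hr.1.le, hr.2.le⟩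
      have a1 := h.ρ_pos r hr' t ht
      have a2 := hbd r hr' t ht
      exact ⟨a1, by linarith⟩
    exact hrhs (fun r => ρ r t) (fun r => ρ r t ^ β) (fun r => ρ r t ^ γ) (fun r => u r t)
      (fun r => dr u r t) (fun r => wq u r t) (fun r => FF μ β γ ρ u r t) (fun r => UD u r t)
      RT k (2 * μ + RT ^ β) p (YY μ β γ R ρ u t + K * p ^ 2)
      d1 d10 d8 d2 d4 d7 dF dU
      (fun r hr => ⟨(hρt r hr).1.le, (hρt r hr).2⟩)
      (fun r hr => by
        obtain ⟨a1, a2⟩ := hρt r hr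
        have : ρ r t ^ β ≤ RT ^ β := Real.rpow_le_rpow a1.le a2 (by linarith)
        exact ⟨by positivity, by linarith⟩)
      (hPp t ht) (fun r _ => h.uw ht r) (h.bc0 t ht) (h.bcR t ht) (fun r _ => rfl)
      (fun r hr => h.F_r hr ht) (fun r _ => h.su.hr r t) hRT1 hk1 hkL hp1
      (by rw [Real.sq_sqrt hc0p.le, hc0]; exact h.g_low hE hX ht) (hy t ht)
  intro t ht
  have hgr := h.gronwall (c := C * (RT * k ^ 2)) (by positivity) hy1
    (fun t ht => (hmain t ⟨ht.1.le, ht.2.le⟩).2) ht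
  have hy0 := h.y0_up hp1 (fun r hr => (hPp 0 h0T r hr).2) hN2p hρ1 hN1p.le hu2
  have i1 : (∫ r in Ioo (0:ℝ) R, (flux μ β γ ρ u r t) ^ 2 / (2 * μ + ρ r t ^ β) * r)
      = wI R (fun r => FF μ β γ ρ u r t ^ 2 * (1 / (2 * μ + |ρ r t ^ β|))) := by
    refine wI_set hR _ _ (fun r hr => ?_)
    have a1 := h.ρ_pos r ⟨hr.1.le, hr.2.le⟩ t ht
    have a2 : 0 < ρ r t ^ β := by positivity
    rw [abs_of_pos a2, flux, h.rdiv_eq ht hr.1.ne', FF]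
    ring
  have i2 : (∫ r in Ioo (0:ℝ) R, (2 * μ + ρ r t ^ β) * (rdiv u r t) ^ 2 * r)
      = DD μ β R ρ u t := by
    refine wI_set hR _ _ (fun r hr => ?_)
    rw [h.rdiv_eq ht hr.1.ne']
  rw [i1, i2]
  obtain ⟨y, hyd⟩ : ∃ y, y = YY μ β γ R ρ u t + K * p ^ 2 := ⟨_, rfl⟩
  obtain ⟨y0, hy0d⟩ : ∃ y0, y0 = YY μ β γ R ρ u 0 + K * p ^ 2 := ⟨_, rfl⟩
  have f1 := hy t ht
  have f2 := hy1 t ht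
  have f3 := (hmain t ht).1
  have f4 := hFg t ht
  have f5 := h.DD_nonneg ht
  have f6 := hy1 0 h0T
  rw [← hyd] at f1 f2 f3 hgr
  rw [← hy0d] at f6 hgr
  rw [← hK, ← hKc, ← hy0d] at hy0
  have hpi := Real.pi_pos
  have g1 : Real.exp 1 + 2 * Real.pi
      * wI R (fun r => FF μ β γ ρ u r t ^ 2 * (1 / (2 * μ + |ρ r t ^ β|)))
      + 2 * Real.pi * DD μ β R ρ u t ≤ C' * y := by
    have b1 : Real.exp 1 * 1 ≤ Real.exp 1 * y := by gcongr
    have b2 : 2 * Real.pi * wI R (fun r => FF μ β γ ρ u r t ^ 2 * (1 / (2 * μ + |ρ r t ^ β|)))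
        ≤ 2 * Real.pi * y := by
      gcongr
      have := sq_nonneg p
      linarith
    have b3 : 2 * Real.pi * DD μ β R ρ u t ≤ 2 * Real.pi * (C * y) := by gcongr
    have b4 : C' * y = Real.exp 1 * y + 2 * Real.pi * y + 2 * Real.pi * (C * y) := by
      rw [hC']; ring
    linarith
  have g2 : Real.log (Real.exp 1 + 2 * Real.pi
      * wI R (fun r => FF μ β γ ρ u r t ^ 2 * (1 / (2 * μ + |ρ r t ^ β|)))
      + 2 * Real.pi * DD μ β R ρ u t) ≤ Real.log C' + Real.log y := by
    rw [← Real.log_mul hC'p.ne' (by linarith)]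
    exact Real.log_le_log (by positivity) g1
  have g3 : Real.log y0 ≤ Real.log Kc + 2 * (γ * Real.log RT) := by
    have : Real.log (Kc * p ^ 2) = Real.log Kc + 2 * (γ * Real.log RT) := by
      rw [Real.log_mul hKcp.ne' (by positivity), Real.log_pow, hp, Real.log_rpow hRT0]
      norm_num
    rw [← this]
    exact Real.log_le_log (by linarith) hy0
  have g4 : Real.log RT ≤ RT := (Real.log_le_sub_one_of_pos hRT0).trans (by linarith)
  have hαβ : 0 < α * β := by positivity
  set Z := RT ^ (α * β + 1) with hZ
  have z1 : 1 ≤ Z := Real.one_le_rpow hRT1 (by linarith)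
  have z2 : RT ≤ Z := by
    calc RT = RT ^ (1:ℝ) := (Real.rpow_one RT).symm
      _ ≤ _ := Real.rpow_le_rpow_of_exponent_le hRT1 (by linarith)
  have z3 : RT * k ^ 2 = (2 * μ + 1) * Z := by
    rw [hk2, hZ, Real.rpow_add hRT0, Real.rpow_one]; ring
  have z4 : 0 ≤ RT ^ (γ - 2 * β + 1) := by positivity
  have q1 : 2 * (γ * Real.log RT) ≤ 2 * γ * Z := by
    have : 2 * γ * Real.log RT ≤ 2 * γ * Z := by gcongr; linarith
    linarith
  have q2 : C * (RT * k ^ 2) * EE γ R ρ u 0 ≤ C * (2 * μ + 1) * E0 * Z := by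
    rw [z3]
    calc C * ((2 * μ + 1) * Z) * EE γ R ρ u 0 ≤ C * ((2 * μ + 1) * Z) * E0 := by gcongr
      _ = _ := by ring
  have q3 : Real.log C' ≤ |Real.log C'| * Z := (le_abs_self _).trans
    (le_mul_of_one_le_right (abs_nonneg _) z1)
  have q4 : Real.log Kc ≤ |Real.log Kc| * Z := (le_abs_self _).trans
    (le_mul_of_one_le_right (abs_nonneg _) z1)
  set Cf := |Real.log C'| + |Real.log Kc| + 2 * γ + C * (2 * μ + 1) * E0 + 1 with hCf
  have hCf0 : 0 ≤ Cf := by positivity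
  have q5 : Cf * Z = |Real.log C'| * Z + |Real.log Kc| * Z + 2 * γ * Z
    + C * (2 * μ + 1) * E0 * Z + Z := by rw [hCf]; ring
  have q6 : 0 ≤ Cf * RT ^ (γ - 2 * β + 1) := by positivity
  rw [mul_add]
  linarith
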